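/- arXiv:1112.1233 — 3 statements merged into one kernel-verified Lean document; each statement's English description precedes it below -/
import Mathlib

section
/- Let V be a simple Euclidean Jordan algebra with cone of squares K, and let Q : V × V → V be a symmetric bilinear map with Q(v,v) ∈ K for all v ∈ V. Then the condition '⟨x, Q(u,v)⟩ = 0 for all v ∈ V and all u,x ∈ K with ⟨u,x⟩ = 0' holds if and only if Q(u,u) = 4 P(u)α for all u ∈ V, where α := Q(e,e)/4; moreover in this case α ∈ K. -/
open MeasureTheory Filter Set
open scoped RealInnerProductSpace ENNReal Topology

/-- A Euclidean Jordan algebra structure on a finite-dimensional real inner product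
space `V`: a commutative bilinear product with unit satisfying the Jordan identity,
compatible with the inner product. -/
structure EuclideanJordanAlgebra (V : Type*) [NormedAddCommGroup V]
    [InnerProductSpace ℝ V] [FiniteDimensional ℝ V] where
  mul : V →ₗ[ℝ] V →ₗ[ℝ] V
  comm : ∀ x y : V, mul x y = mul y x
  jordan : ∀ x y : V, mul (mul x x) (mul x y) = mul x (mul (mul x x) y)
  e : V
  unit : ∀ x : V, mul e x = x
  compat : ∀ x y z : V, ⟪mul x y, z⟫ = ⟪y, mul x z⟫

namespace EuclideanJordanAlgebra

variable {V : Type*} [NormedAddCommGroup V] [InnerProductSpace ℝ V]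
  [FiniteDimensional ℝ V] (J : EuclideanJordanAlgebra V)

/-- The left multiplication operator `L(x) y = x ∘ y`. -/
def L (x : V) : V →ₗ[ℝ] V := J.mul x

/-- The quadratic representation `P(x) = 2 L(x)² − L(x ∘ x)`. -/
def P (x : V) : V →ₗ[ℝ] V := (2 : ℝ) • (J.L x ∘ₗ J.L x) - J.L (J.mul x x)

/-- The cone of squares `K = {x ∘ x : x ∈ V}`. -/
def cone : Set V := {y | ∃ x : V, y = J.mul x x}

/-- The Jordan algebra is simple: it is nontrivial and its only ideals are `⊥` and
`⊤`. -/
def IsSimple : Prop :=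
  Nontrivial V ∧
    ∀ I : Submodule ℝ V, (∀ x : V, ∀ y ∈ I, J.mul x y ∈ I) → I = ⊥ ∨ I = ⊤

/-- `p` is an idempotent: `p ∘ p = p`. -/
def IsIdempotent (p : V) : Prop := J.mul p p = p

/-- `p` is a primitive idempotent: a nonzero idempotent that is not the sum of two
nonzero orthogonal idempotents. -/
def IsPrimitive (p : V) : Prop :=
  J.IsIdempotent p ∧ p ≠ 0 ∧
    ¬∃ q₁ q₂ : V, J.IsIdempotent q₁ ∧ J.IsIdempotent q₂ ∧ q₁ ≠ 0 ∧ q₂ ≠ 0 ∧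
      J.mul q₁ q₂ = 0 ∧ p = q₁ + q₂

/-- A Jordan frame: a family of pairwise orthogonal primitive idempotents summing to
the unit. -/
def IsJordanFrame {k : ℕ} (p : Fin k → V) : Prop :=
  (∀ i, J.IsPrimitive (p i)) ∧ (∀ i j, i ≠ j → J.mul (p i) (p j) = 0) ∧
    (∑ i, p i) = J.e

/-- The Jordan algebra has rank `r`: there is a Jordan frame of cardinality `r` and
every Jordan frame has cardinality `r`. -/
def HasRank (r : ℕ) : Prop :=
  (∃ p : Fin r → V, J.IsJordanFrame p) ∧
    ∀ (k : ℕ) (p : Fin k → V), J.IsJordanFrame p → k = r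

/-- The off-diagonal Peirce space `V_{ab}` of two idempotents: the common
`1/2`-eigenspace of `L(a)` and `L(b)`. -/
noncomputable def peirceSpace (a b : V) : Submodule ℝ V :=
  LinearMap.ker (J.mul a - (1/2 : ℝ) • LinearMap.id) ⊓
    LinearMap.ker (J.mul b - (1/2 : ℝ) • LinearMap.id)

/-- The Jordan algebra has Peirce invariant `d`: all off-diagonal Peirce spaces of
Jordan frames have dimension `d`. -/
def HasPeirceInvariant (d : ℕ) : Prop :=
  ∀ (k : ℕ) (p : Fin k → V), J.IsJordanFrame p → ∀ i j : Fin k, i ≠ j →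
    Module.finrank ℝ (J.peirceSpace (p i) (p j)) = d

/-- The inner product is the trace form, normalized so that `⟪p, p⟫ = 1` for every
primitive idempotent `p`. -/
def TraceNormalized : Prop := ∀ p : V, J.IsPrimitive p → ⟪p, p⟫ = 1

end EuclideanJordanAlgebra

namespace EuclideanJordanAlgebra

variable {V : Type*} [NormedAddCommGroup V] [InnerProductSpace ℝ V]
  [FiniteDimensional ℝ V] (J : EuclideanJordanAlgebra V)

/-- The fully linearized Jordan identity. -/
lemma jordan_lin (a b c y : V) :
    J.mul (J.mul b c) (J.mul a y) + J.mul (J.mul a c) (J.mul b y)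
      + J.mul (J.mul a b) (J.mul c y)
    = J.mul a (J.mul (J.mul b c) y) + J.mul b (J.mul (J.mul a c) y)
      + J.mul c (J.mul (J.mul a b) y) := by
  have h1 := J.jordan (a + b + c) y
  have h2 := J.jordan (a + b) y
  have h3 := J.jordan (a + c) y
  have h4 := J.jordan (b + c) y
  have h5 := J.jordan a y
  have h6 := J.jordan b y
  have h7 := J.jordan c y
  simp only [map_add, LinearMap.add_apply, J.comm b a, J.comm c a, J.comm c b] at h1 h2 h3 h4
  linear_combination (norm := module) (1/2 : ℝ) • h1 - (1/2 : ℝ) • h2 - (1/2 : ℝ) • h3 - (1/2 : ℝ) • h4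
    + (1/2 : ℝ) • h5 + (1/2 : ℝ) • h6 + (1/2 : ℝ) • h7

/-- Operator recursion for powers. -/
lemma pow_rec (x z w : V) :
    J.mul (J.mul x (J.mul x z)) w =
      (2 : ℝ) • J.mul (J.mul x z) (J.mul x w) + J.mul (J.mul x x) (J.mul z w)
      - J.mul x (J.mul x (J.mul z w)) - J.mul z (J.mul x (J.mul x w)) := by
  have h := J.jordan_lin w x z x
  rw [J.comm w x, J.comm w z, J.comm (J.mul x z) x, J.comm z x,
    J.comm (J.mul x w) x, J.comm (J.mul z w) (J.mul x x), J.comm (J.mul z w) x,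
    J.comm w, J.comm (J.mul x w) (J.mul x z)] at h
  linear_combination (norm := module) -h

lemma pow_comm (x : V) (n : ℕ) :
    ∀ w, J.mul (((J.mul x) ^ n) J.e) (J.mul x w) = J.mul x (J.mul (((J.mul x) ^ n) J.e) w) := by
  induction n using Nat.twoStepInduction with
  | zero => intro w; simp [J.unit]
  | one => intro w; simp [J.comm x J.e, J.unit]
  | more n h0 h1 =>
    intro w
    have e2 : ((J.mul x) ^ (n + 2)) J.e = J.mul x (J.mul x (((J.mul x) ^ n) J.e)) := by
      rw [pow_succ', pow_succ']; rfl
    have e1 : ((J.mul x) ^ (n + 1)) J.e = J.mul x (((J.mul x) ^ n) J.e) := by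
      rw [pow_succ']; rfl
    rw [e1] at h1
    rw [e2, pow_rec, pow_rec]
    simp only [map_add, map_sub, map_smul, h0, h1, J.jordan]

/-- `p ↦ p(x)`. -/
noncomputable def ev (x : V) (p : Polynomial ℝ) : V := (Polynomial.aeval (J.mul x) p) J.e

lemma ev_comm (x : V) (p : Polynomial ℝ) (w : V) :
    J.mul (J.ev x p) (J.mul x w) = J.mul x (J.mul (J.ev x p) w) := by
  unfold ev
  induction p using Polynomial.induction_on' with
  | add p q hp hq => simp only [map_add, LinearMap.add_apply, hp, hq]
  | monomial n a =>
    simp only [Polynomial.aeval_monomial, Algebra.algebraMap_eq_smul_one, smul_mul_assoc, one_mul,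
      LinearMap.smul_apply, map_smul, pow_comm]

lemma ev_mul (x : V) (p q : Polynomial ℝ) :
    J.mul (J.ev x p) (J.ev x q) = J.ev x (q * p) := by
  have hc : Commute (J.mul (J.ev x p)) (J.mul x) := LinearMap.ext fun w => J.ev_comm x p w
  have h2 : Commute (J.mul (J.ev x p)) (Polynomial.aeval (J.mul x) q) := by
    induction q using Polynomial.induction_on' with
    | add p q hp hq => rw [map_add]; exact hp.add_right hq
    | monomial n a =>
      rw [Polynomial.aeval_monomial, Algebra.algebraMap_eq_smul_one, smul_mul_assoc, one_mul]
      exact (hc.pow_right n).smul_right a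
  have h3 := LinearMap.congr_fun h2.eq J.e
  simp only [Module.End.mul_apply] at h3
  change J.mul (J.ev x p) ((Polynomial.aeval (J.mul x) q) J.e) = _
  rw [h3, J.comm _ J.e, J.unit]
  simp [ev]

lemma mul_symmetric (x : V) : (J.mul x).IsSymmetric := fun y z => J.compat x y z

/-- Spectral theorem. -/
lemma spectral (x : V) : ∃ (S : Finset ℝ) (c : ℝ → V),
    (∀ s ∈ S, J.mul (c s) (c s) = c s) ∧
    (∀ s ∈ S, ∀ t ∈ S, s ≠ t → J.mul (c s) (c t) = 0) ∧
    x = ∑ s ∈ S, s • c s := by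
  classical
  have hT := J.mul_symmetric x
  let b := hT.eigenvectorBasis rfl
  let t := hT.eigenvalues rfl
  let S : Finset ℝ := Finset.univ.image t
  have hzero : ∀ p : Polynomial ℝ, (∀ s ∈ S, p.eval s = 0) → J.ev x p = 0 := by
    intro p hp
    have : Polynomial.aeval (J.mul x) p = 0 := by
      apply b.toBasis.ext
      intro i
      have hi : Module.End.HasEigenvector (J.mul x) (t i) (b i) := hT.hasEigenvector_eigenvectorBasis rfl i
      have := Module.End.aeval_apply_of_hasEigenvector (p := p) hi
      rw [OrthonormalBasis.coe_toBasis, this, hp _ (Finset.mem_image_of_mem _ (Finset.mem_univ i))]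
      simp
    simp [ev, this]
  have hev_sub : ∀ p q, J.ev x (p - q) = J.ev x p - J.ev x q := by
    intro p q; simp [ev]
  have heq : ∀ p q : Polynomial ℝ, (∀ s ∈ S, p.eval s = q.eval s) → J.ev x p = J.ev x q := by
    intro p q h
    rw [← sub_eq_zero, ← hev_sub]
    apply hzero
    intro s hs
    simp [h s hs]
  have hb : ∀ s ∈ S, ∀ r ∈ S, (Lagrange.basis S id s).eval r = if s = r then 1 else 0 := by
    intro s hs r hr
    split_ifs with h
    · subst h
      exact Lagrange.eval_basis_self (v := id) (Set.injOn_id _) hs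
    · exact Lagrange.eval_basis_of_ne (v := id) h hr
  refine ⟨S, fun s => J.ev x (Lagrange.basis S id s), ?_, ?_, ?_⟩
  · intro s hs
    rw [ev_mul]
    apply heq
    intro r hr
    simp [hb s hs r hr]
  · intro s hs r hr hsr
    rw [ev_mul]
    apply hzero
    intro q hq
    rw [Polynomial.eval_mul, hb s hs q hq, hb r hr q hq]
    split_ifs <;> simp_all
  · have h1 : x = J.ev x Polynomial.X := by
      simp [ev, J.comm x, J.unit]
    have h2 : ∑ s ∈ S, s • J.ev x (Lagrange.basis S id s)
        = J.ev x (∑ s ∈ S, s • Lagrange.basis S id s) := by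
      simp [ev, LinearMap.sum_apply]
    rw [h2]
    conv_lhs => rw [h1]
    apply heq
    intro r hr
    rw [Polynomial.eval_finsetSum, Polynomial.eval_X, Finset.sum_congr rfl
      (fun s hs => by rw [Polynomial.eval_smul, hb s hs r hr])]
    simp [hr]

lemma peirce {c : V} (hc : J.mul c c = c) (w : V) :
    (3 : ℝ) • J.mul c (J.mul c w) = (2 : ℝ) • J.mul c (J.mul c (J.mul c w)) + J.mul c w := by
  have h := J.jordan_lin w c c c
  rw [hc, J.comm w c, J.comm (J.mul c w) c, hc, J.comm w c] at h
  linear_combination (norm := module) h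

lemma idem_nonneg {c : V} (hc : J.mul c c = c) (w : V) : 0 ≤ ⟪J.mul c w, w⟫ := by
  have hp := J.peirce hc
  set z := J.mul c w - J.mul c (J.mul c w) with hz
  have h1 : ⟪J.mul c w, J.mul c w⟫ = ⟪J.mul c (J.mul c w), w⟫ := by
    rw [J.compat c (J.mul c w) w]
  have h3 : ⟪z, z⟫ = ⟪J.mul c z - J.mul c (J.mul c z), w⟫ := by
    rw [inner_sub_left (J.mul c z), J.compat c (J.mul c z), J.compat c z w, J.compat c z,
      ← inner_sub_right]
  have h4 : (4 : ℝ) • (J.mul c z - J.mul c (J.mul c z)) = J.mul c w - J.mul c (J.mul c w) := by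
    simp only [hz, map_sub]
    have a := hp w
    have b := hp (J.mul c w)
    linear_combination (norm := module) (3 : ℝ) • a - (2 : ℝ) • b - (2 : ℝ) • a
  have h5 : 4 * ⟪z, z⟫ = ⟪J.mul c w, w⟫ - ⟪J.mul c (J.mul c w), w⟫ := by
    rw [h3, ← inner_sub_left, ← h4, real_inner_smul_left]
  have p1 : 0 ≤ ⟪z, z⟫ := real_inner_self_nonneg
  have p2 : 0 ≤ ⟪J.mul c w, J.mul c w⟫ := real_inner_self_nonneg
  linarith

/-- Spectral theorem for the cone. -/
lemma spectral_cone {x : V} (hx : x ∈ J.cone) : ∃ (S : Finset ℝ) (c : ℝ → V),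
    (∀ s ∈ S, J.mul (c s) (c s) = c s) ∧
    (∀ s ∈ S, ∀ t ∈ S, s ≠ t → J.mul (c s) (c t) = 0) ∧
    x = ∑ s ∈ S, (s ^ 2) • c s := by
  obtain ⟨y, rfl⟩ := hx
  obtain ⟨S, c, h1, h2, h3⟩ := J.spectral y
  refine ⟨S, c, h1, h2, ?_⟩
  conv_lhs => rw [h3]
  simp only [map_sum, LinearMap.sum_apply, map_smul, LinearMap.smul_apply]
  apply Finset.sum_congr rfl
  intro s hs
  rw [Finset.sum_eq_single s]
  · rw [h1 s hs, smul_smul, sq]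
  · intro r hr hrs
    first
      | rw [h2 s hs r hr hrs.symm, smul_zero]
      | rw [h2 r hr s hs hrs, smul_zero]
  · exact fun h => absurd hs h

lemma cone_nonneg {x : V} (hx : x ∈ J.cone) (w : V) : 0 ≤ ⟪J.mul x w, w⟫ := by
  obtain ⟨S, c, h1, -, rfl⟩ := J.spectral_cone hx
  simp only [map_sum, LinearMap.sum_apply, map_smul, LinearMap.smul_apply, sum_inner,
    real_inner_smul_left]
  exact Finset.sum_nonneg fun s hs => mul_nonneg (sq_nonneg s) (J.idem_nonneg (h1 s hs) w)

lemma cone_inner_nonneg {x y : V} (hx : x ∈ J.cone) (hy : y ∈ J.cone) : 0 ≤ ⟪x, y⟫ := by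
  obtain ⟨z, rfl⟩ := hy
  rw [real_inner_comm, J.compat, J.comm z x, real_inner_comm]
  exact J.cone_nonneg hx z

/-- Degenerate vectors of a positive semidefinite form. -/
lemma form_zero (B : V →ₗ[ℝ] V →ₗ[ℝ] ℝ) (hs : ∀ u v, B u v = B v u) (hp : ∀ v, 0 ≤ B v v)
    {u : V} (hu : B u u = 0) (v : V) : B u v = 0 := by
  by_contra hne
  have h := hp (v - ((B v v + 1) / (2 * B u v)) • u)
  simp only [map_sub, LinearMap.sub_apply, map_smul, LinearMap.smul_apply, smul_eq_mul, hu,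
    hs v u] at h
  have : (B v v + 1) / (2 * B u v) * B u v = (B v v + 1) / 2 := by field_simp
  linarith

lemma cone_mul_idem {x c : V} (hx : x ∈ J.cone) (hc : J.mul c c = c) (h : ⟪c, x⟫ = 0) :
    J.mul x c = 0 := by
  let B : V →ₗ[ℝ] V →ₗ[ℝ] ℝ := (innerₗ V).comp (J.mul x)
  have hB : ∀ u v, B u v = ⟪J.mul x u, v⟫ := fun u v => rfl
  have h0 : B c c = 0 := by
    rw [hB, J.comm, J.compat, hc, real_inner_comm, h]
  have := form_zero B (fun u v => by rw [hB, hB, J.compat, real_inner_comm])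
    (fun v => J.cone_nonneg hx v) h0 (J.mul x c)
  rw [hB] at this
  exact inner_self_eq_zero.mp this

lemma P_apply (x y : V) : J.P x y = (2 : ℝ) • J.mul x (J.mul x y) - J.mul (J.mul x x) y := by
  simp [P, L]

lemma P_symm (x y z : V) : ⟪J.P x y, z⟫ = ⟪y, J.P x z⟫ := by
  simp only [P_apply, inner_sub_left, inner_sub_right, real_inner_smul_left,
    real_inner_smul_right, J.compat]

lemma P_orth {u x : V} (hu : u ∈ J.cone) (hx : x ∈ J.cone) (h : ⟪u, x⟫ = 0) : J.P u x = 0 := by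
  obtain ⟨S, c, h1, h2, h3⟩ := J.spectral_cone hu
  have hc : ∀ s ∈ S, s ^ 2 • J.mul (c s) x = 0 := by
    intro s hs
    have h4 : ∑ s ∈ S, s ^ 2 * ⟪c s, x⟫ = 0 := by
      rw [← h, h3, sum_inner]
      simp only [real_inner_smul_left]
    have h5 := (Finset.sum_eq_zero_iff_of_nonneg (fun r hr => mul_nonneg (sq_nonneg r)
      (J.cone_inner_nonneg (x := c r) (y := x) ⟨c r, (h1 r hr).symm⟩ hx))).mp h4 s hs
    rcases mul_eq_zero.mp h5 with h6 | h6
    · rw [h6, zero_smul]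
    · rw [J.comm, J.cone_mul_idem hx (h1 s hs) h6, smul_zero]
  have hux : J.mul u x = 0 := by
    rw [h3]
    simp only [map_sum, LinearMap.sum_apply, map_smul, LinearMap.smul_apply]
    exact Finset.sum_eq_zero hc
  have huu : J.mul u u = ∑ s ∈ S, (s ^ 2 * s ^ 2) • c s := by
    rw [h3]
    simp only [map_sum, LinearMap.sum_apply, map_smul, LinearMap.smul_apply]
    apply Finset.sum_congr rfl
    intro s hs
    rw [Finset.sum_eq_single s]
    · rw [h1 s hs, smul_smul]
    · intro r hr hrs
      first
        | rw [h2 s hs r hr hrs.symm, smul_zero]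
        | rw [h2 r hr s hs hrs, smul_zero]
    · exact fun h => absurd hs h
  have huux : J.mul (J.mul u u) x = 0 := by
    rw [huu]
    simp only [map_sum, LinearMap.sum_apply, map_smul, LinearMap.smul_apply]
    apply Finset.sum_eq_zero
    intro s hs
    rw [mul_smul, hc s hs, smul_zero]
  rw [P_apply, hux, huux]
  simp

lemma compl_idem {c : V} (hc : J.mul c c = c) :
    J.mul (J.e - c) (J.e - c) = J.e - c := by
  simp [J.unit, J.comm c J.e, hc]

/-- The main condition kills the complementary Peirce component. -/
lemma P_compl_eq_zero (Q : V →ₗ[ℝ] V →ₗ[ℝ] V)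
    (H : ∀ u ∈ J.cone, ∀ x ∈ J.cone, ⟪u, x⟫ = 0 → ∀ v : V, ⟪x, Q u v⟫ = 0)
    {c : V} (hc : J.mul c c = c) (v : V) : J.P (J.e - c) (Q c v) = 0 := by
  have hd := J.compl_idem hc
  set d := J.e - c with hdd
  have hcd : J.mul c d = 0 := by simp [hdd, J.comm c J.e, J.unit, hc]
  refine ext_inner_right ℝ fun w => ?_
  rw [P_symm, inner_zero_left]
  set y := J.P d w with hy
  have hdy : J.mul d y = y := by
    rw [hy, P_apply, hd, map_sub, map_smul]
    linear_combination (norm := module) -J.peirce hd w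
  have hcy : J.mul c y = 0 := by
    have : c = J.e - d := by simp [hdd]
    rw [this, map_sub, LinearMap.sub_apply, J.unit, hdy, sub_self]
  have key : ∀ z, J.mul c z = 0 → ⟪J.mul z z, Q c v⟫ = 0 := by
    intro z hz
    refine H c ⟨c, hc.symm⟩ _ ⟨z, rfl⟩ ?_ v
    rw [real_inner_comm, J.compat, J.comm z c, hz, inner_zero_right]
  have k1 := key (y + d) (by rw [map_add, hcy, hcd, add_zero])
  have k2 := key (y - d) (by rw [map_sub, hcy, hcd, sub_zero])
  have e1 : J.mul (y + d) (y + d) = J.mul (y - d) (y - d) + (4 : ℝ) • y := by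
    simp only [map_add, map_sub, LinearMap.add_apply, LinearMap.sub_apply, J.comm y d, hdy]
    module
  rw [e1, inner_add_left, k2, real_inner_smul_left] at k1
  rw [real_inner_comm]
  linarith

lemma Q_idem (Q : V →ₗ[ℝ] V →ₗ[ℝ] V) (hsymm : ∀ u v : V, Q u v = Q v u)
    (hpos : ∀ v : V, Q v v ∈ J.cone)
    (H : ∀ u ∈ J.cone, ∀ x ∈ J.cone, ⟪u, x⟫ = 0 → ∀ v : V, ⟪x, Q u v⟫ = 0)
    {c : V} (hc : J.mul c c = c) : Q c c = J.P c (Q J.e J.e) := by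
  have hd := J.compl_idem hc
  have hP : ∀ v, J.P c (Q (J.e - c) v) = 0 := by
    intro v
    have := J.P_compl_eq_zero Q H hd v
    rwa [sub_sub_cancel] at this
  have hcd : J.mul c (J.e - c) = 0 := by simp [J.comm c J.e, J.unit, hc]
  have hQd : ⟪J.e - c, Q c c⟫ = 0 := by
    refine H c ⟨c, hc.symm⟩ _ ⟨_, hd.symm⟩ ?_ c
    rw [← hc, J.compat, hc, hcd, inner_zero_right]
  have h1 := J.cone_mul_idem (hpos c) hd hQd
  have h2 : J.mul c (Q c c) = Q c c := by
    rw [J.comm, map_sub, LinearMap.sub_apply, J.unit, sub_eq_zero] at h1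
    exact h1.symm
  have h3 : J.P c (Q c c) = Q c c := by
    rw [P_apply, hc, h2, h2]; module
  have h4 : Q J.e J.e = Q c c + Q (J.e - c) c + Q (J.e - c) J.e := by
    have := hsymm c J.e
    simp only [map_sub, LinearMap.sub_apply, this]
    abel
  rw [h4, map_add, map_add, hP, hP, h3]
  simp

lemma forward (Q : V →ₗ[ℝ] V →ₗ[ℝ] V) (hsymm : ∀ u v : V, Q u v = Q v u)
    (hpos : ∀ v : V, Q v v ∈ J.cone)
    (H : ∀ u ∈ J.cone, ∀ x ∈ J.cone, ⟪u, x⟫ = 0 → ∀ v : V, ⟪x, Q u v⟫ = 0)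
    (u : V) : Q u u = J.P u (Q J.e J.e) := by
  set a := Q J.e J.e with ha
  let F : V →ₗ[ℝ] V →ₗ[ℝ] V := LinearMap.mk₂ ℝ (fun u v => Q u v -
      (J.mul u (J.mul v a) + J.mul v (J.mul u a) - J.mul (J.mul u v) a))
    (by intros; simp only [map_add, LinearMap.add_apply]; module)
    (by intros; simp only [map_smul, LinearMap.smul_apply]; module)
    (by intros; simp only [map_add, LinearMap.add_apply]; module)
    (by intros; simp only [map_smul, LinearMap.smul_apply]; module)
  have hF : ∀ u v, F u v = Q u v -
      (J.mul u (J.mul v a) + J.mul v (J.mul u a) - J.mul (J.mul u v) a) := fun u v => rfl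
  have hF0 : ∀ c, J.mul c c = c → F c c = 0 := by
    intro c hc
    have := J.Q_idem Q hsymm hpos H hc
    rw [P_apply] at this
    rw [hF, this]
    module
  have hF1 : ∀ c d, J.mul c c = c → J.mul d d = d → J.mul c d = 0 → F c d = 0 := by
    intro c d hc hd hcd
    have h := hF0 (c + d) (by
      simp only [map_add, LinearMap.add_apply, hc, hd, hcd, J.comm d c]; simp)
    have h1 := hF0 c hc
    have h2 := hF0 d hd
    simp only [hF, map_add, LinearMap.add_apply, J.comm d c, hsymm d c] at h h1 h2 ⊢
    linear_combination (norm := module) (1/2 : ℝ) • h - (1/2 : ℝ) • h1 - (1/2 : ℝ) • h2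
  obtain ⟨S, c, h1, h2, h3⟩ := J.spectral u
  have hsum : F u u = ∑ s ∈ S, ∑ r ∈ S, (s * r) • F (c s) (c r) := by
    rw [h3]
    simp only [map_sum, LinearMap.sum_apply, map_smul, LinearMap.smul_apply, mul_smul,
      Finset.smul_sum]
    try
      rw [Finset.sum_comm]
      try exact Finset.sum_congr rfl fun s _ => Finset.sum_congr rfl fun r _ => smul_comm _ _ _
  have hz : F u u = 0 := by
    rw [hsum]
    refine Finset.sum_eq_zero fun s hs => Finset.sum_eq_zero fun r hr => ?_
    by_cases hsr : s = r
    · subst hsr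
      rw [hF0 _ (h1 s hs), smul_zero]
    · rw [hF1 _ _ (h1 s hs) (h1 r hr) (h2 s hs r hr hsr), smul_zero]
  rw [hF, sub_eq_zero] at hz
  rw [hz, P_apply]
  module

lemma backward (Q : V →ₗ[ℝ] V →ₗ[ℝ] V) (hsymm : ∀ u v : V, Q u v = Q v u)
    (hpos : ∀ v : V, Q v v ∈ J.cone) (a : V) (H : ∀ u, Q u u = J.P u a)
    {u x : V} (hu : u ∈ J.cone) (hx : x ∈ J.cone) (h : ⟪u, x⟫ = 0) (v : V) :
    ⟪x, Q u v⟫ = 0 := by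
  let B : V →ₗ[ℝ] V →ₗ[ℝ] ℝ := Q.compr₂ (innerₗ V x)
  have hB : ∀ u v, B u v = ⟪x, Q u v⟫ := fun u v => rfl
  rw [← hB]
  refine form_zero B (fun u v => by rw [hB, hB, hsymm])
    (fun v => J.cone_inner_nonneg hx (hpos v)) ?_ v
  rw [hB, H, ← P_symm, J.P_orth hu hx h, inner_zero_left]

end EuclideanJordanAlgebra

/-- In a simple Euclidean Jordan algebra `V` with cone of squares
`K`, a symmetric bilinear map `Q` with `Q(v,v) ∈ K` satisfies
`⟪x, Q(u,v)⟫ = 0` for all `v ∈ V` and all `u,x ∈ K` with `⟪u,x⟫ = 0` if and only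
if `Q(u,u) = 4 P(u) α` for all `u ∈ V`, where `α = Q(e,e)/4`; moreover `α ∈ K`. -/
theorem diffusion_coefficient_quadratic_representation
    {V : Type*} [NormedAddCommGroup V] [InnerProductSpace ℝ V] [FiniteDimensional ℝ V]
    (J : EuclideanJordanAlgebra V) (hsimple : J.IsSimple)
    (Q : V →ₗ[ℝ] V →ₗ[ℝ] V) (hsymm : ∀ u v : V, Q u v = Q v u)
    (hpos : ∀ v : V, Q v v ∈ J.cone) :
    ((∀ u ∈ J.cone, ∀ x ∈ J.cone, ⟪u, x⟫ = 0 → ∀ v : V, ⟪x, Q u v⟫ = 0) ↔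
      (∀ u : V, Q u u = (4 : ℝ) • J.P u ((1/4 : ℝ) • Q J.e J.e))) ∧
    (1/4 : ℝ) • Q J.e J.e ∈ J.cone := by
  have hP : ∀ u : V, (4 : ℝ) • J.P u ((1/4 : ℝ) • Q J.e J.e) = J.P u (Q J.e J.e) := by
    intro u
    rw [map_smul, smul_smul]
    norm_num
  refine ⟨⟨fun H u => ?_, fun H u hu x hx h v => ?_⟩, ?_⟩
  · rw [hP]
    exact J.forward Q hsymm hpos H u
  · exact J.backward Q hsymm hpos (Q J.e J.e) (fun u => by rw [H u, hP]) hu hx h v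
  · obtain ⟨y, hy⟩ := hpos J.e
    refine ⟨(1/2 : ℝ) • y, ?_⟩
    rw [hy, map_smul, map_smul, LinearMap.smul_apply, smul_smul]
    norm_num
end

section
/- Let V be a simple Euclidean Jordan algebra of rank r and Peirce invariant d, with trace-normalized inner product, and let K be its cone of squares. Let (p_t(x,·)) be an affine family of transition kernels on K with associated functions φ and ψ, and suppose that for every u ∈ K* the derivatives F(u) := ∂_t φ(t,u)|_{t=0} and R(u) := ∂_t ψ(t,u)|_{t=0} exist, that F is of form (F) with constant drift parameter b ∈ K, and that R is of form (R) with parameters (Q,Bᵀ,γ,M) where Q(u,u) = 4 P(u)α for some α ∈ K. Then b − d(r−1)α ∈ K, i.e. b ⪰ d(r−1)α. -/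
open MeasureTheory Filter Set
open scoped RealInnerProductSpace ENNReal Topology

variable {V : Type*} [NormedAddCommGroup V] [InnerProductSpace ℝ V] [FiniteDimensional ℝ V]
  [MeasurableSpace V] [BorelSpace V]

/-- The closed dual cone of a set `K`. -/
def dualCone (K : Set V) : Set V := {u | ∀ x ∈ K, 0 ≤ ⟪x, u⟫}

/-- `K` is a proper (pointed) generating closed convex cone. -/
structure IsProperConvexCone (K : Set V) : Prop where
  isClosed : IsClosed K
  convex : Convex ℝ K
  smul_mem : ∀ (c : ℝ), 0 ≤ c → ∀ x ∈ K, c • x ∈ K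
  proper : K ∩ (-K) = {0}
  generating : ∀ v : V, ∃ x ∈ K, ∃ y ∈ K, v = x - y

/-- An affine family of transition kernels on the cone `K`, with associated
functions `φ` and `ψ`. -/
structure AffineTransitionFamily (K : Set V) (φ : ℝ → V → ℝ) (ψ : ℝ → V → V) where
  p : ℝ → V → Measure V
  measurable_p : ∀ t : ℝ, 0 ≤ t → ∀ A : Set V, MeasurableSet A →
      Measurable fun x => p t x A
  subprob : ∀ t : ℝ, 0 ≤ t → ∀ x ∈ K, p t x Set.univ ≤ 1
  supported : ∀ t : ℝ, 0 ≤ t → ∀ x ∈ K, p t x Kᶜ = 0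
  init : ∀ x ∈ K, p 0 x = Measure.dirac x
  chapman : ∀ s t : ℝ, 0 ≤ s → 0 ≤ t → ∀ x ∈ K, ∀ A : Set V, MeasurableSet A →
      p (t + s) x A = ∫⁻ ξ, p t ξ A ∂(p s x)
  weakCont : ∀ x ∈ K, ∀ f : BoundedContinuousFunction V ℝ,
      ContinuousOn (fun s => ∫ ξ, f ξ ∂(p s x)) (Set.Ici (0 : ℝ))
  laplace : ∀ t : ℝ, 0 ≤ t → ∀ u ∈ dualCone K, ∀ x ∈ K,
      ∫ ξ, Real.exp (-⟪u, ξ⟫) ∂(p t x) = Real.exp (-(φ t u) - ⟪ψ t u, x⟫)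

/-- `χ` is a truncation function: continuous, bounded in norm by `1`, and equal to
the identity on a neighborhood of the origin. -/
def IsTruncation {V : Type*} [NormedAddCommGroup V] (χ : V → V) : Prop :=
  Continuous χ ∧ (∀ ξ : V, ‖χ ξ‖ ≤ 1) ∧ ∀ᶠ ξ in nhds (0 : V), χ ξ = ξ

/-- Parameters witnessing that `F` is of form (F). -/
structure FParams {V : Type*} [NormedAddCommGroup V] [InnerProductSpace ℝ V]
    [MeasurableSpace V] (K : Set V) (F : V → ℝ) where
  b : V
  b_mem : b ∈ K
  c : ℝ
  c_nonneg : 0 ≤ c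
  m : Measure V
  m_supp : m Kᶜ = 0
  m_zero : m {0} = 0
  m_int : (∫⁻ ξ, ENNReal.ofReal (min ‖ξ‖ 1) ∂m) < ⊤
  eq : ∀ u ∈ dualCone K, F u = ⟪b, u⟫ + c - ∫ ξ, (Real.exp (-⟪u, ξ⟫) - 1) ∂m

/-- Parameters witnessing that `R` is of form (R) relative to the truncation
function `χ`. -/
structure RParams {V : Type*} [NormedAddCommGroup V] [InnerProductSpace ℝ V]
    [MeasurableSpace V] (K : Set V) (χ : V → V) (R : V → V) where
  Q : V →ₗ[ℝ] V →ₗ[ℝ] V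
  Q_symm : ∀ u v : V, Q u v = Q v u
  Q_pos : ∀ v : V, Q v v ∈ dualCone K
  B : V →ₗ[ℝ] V
  γ : V
  γ_mem : γ ∈ dualCone K
  M : V → Measure V
  M_sigma : ∀ x ∈ K, SigmaFinite (M x)
  M_add : ∀ x ∈ K, ∀ y ∈ K, M (x + y) = M x + M y
  M_smul : ∀ (c : ℝ), 0 ≤ c → ∀ x ∈ K, M (c • x) = ENNReal.ofReal c • M x
  M_supp : ∀ x ∈ K, M x Kᶜ = 0
  M_zero : ∀ x ∈ K, M x {0} = 0
  M_int : ∀ x ∈ K, (∫⁻ ξ, ENNReal.ofReal (min (‖ξ‖ ^ 2) 1) ∂(M x)) < ⊤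
  eq : ∀ u ∈ dualCone K, ∀ x ∈ K,
    ⟪R u, x⟫ = -(1/2) * ⟪Q u u, x⟫ + ⟪B u, x⟫ + ⟪γ, x⟫
      - ∫ ξ, (Real.exp (-⟪u, ξ⟫) - 1 + ⟪χ ξ, u⟫) ∂(M x)

/-- The parameters of form (R) are admissible. -/
def RParams.Admissible {V : Type*} [NormedAddCommGroup V] [InnerProductSpace ℝ V]
    [MeasurableSpace V] {K : Set V} {χ : V → V} {R : V → V}
    (P : RParams K χ R) : Prop :=
  ∀ u ∈ dualCone K, ∀ x ∈ K, ⟪u, x⟫ = 0 →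
    (∀ v : V, ⟪P.Q u v, x⟫ = 0) ∧
    Integrable (fun ξ => ⟪χ ξ, u⟫) (P.M x) ∧
    0 ≤ ⟪P.B u, x⟫ - ∫ ξ, ⟪χ ξ, u⟫ ∂(P.M x)

open scoped RealInnerProductSpace ENNReal Topology

namespace DC

section jordan
variable {E : Type*} [NormedAddCommGroup E] [InnerProductSpace ℝ E] [FiniteDimensional ℝ E]
  (J : EuclideanJordanAlgebra E)

lemma lin1 (x y z : E) :
    (2:ℝ) • J.mul (J.mul x z) (J.mul x y) + J.mul (J.mul x x) (J.mul z y)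
      = (2:ℝ) • J.mul x (J.mul (J.mul x z) y) + J.mul z (J.mul (J.mul x x) y) := by
  have h1 := J.jordan (x + z) y
  have h2 := J.jordan (x - z) y
  have h3 := J.jordan z y
  simp only [map_add, map_sub, LinearMap.add_apply, LinearMap.sub_apply] at h1 h2
  simp only [J.comm z x] at h1 h2
  linear_combination (norm := module) (1/2:ℝ) • h1 - (1/2:ℝ) • h2 - h3

lemma lin2 (x w z y : E) :
    J.mul (J.mul x z) (J.mul w y) + J.mul (J.mul w z) (J.mul x y)
      + J.mul (J.mul x w) (J.mul z y)
      = J.mul x (J.mul (J.mul w z) y) + J.mul w (J.mul (J.mul x z) y)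
        + J.mul z (J.mul (J.mul x w) y) := by
  have h1 := lin1 J (x + w) y z
  have h2 := lin1 J x y z
  have h3 := lin1 J w y z
  simp only [map_add, LinearMap.add_apply, J.comm w x, smul_add] at h1
  linear_combination (norm := module) (1/2:ℝ) • h1 - (1/2:ℝ) • h2 - (1/2:ℝ) • h3

/-- operator formula for `L (a² z)` -/
lemma lsq (a z y : E) : J.mul (J.mul (J.mul a a) z) y
    = (2:ℝ) • J.mul (J.mul a z) (J.mul a y) + J.mul (J.mul a a) (J.mul z y)
      - (2:ℝ) • J.mul a (J.mul z (J.mul a y)) := by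
  have h := lin2 J a a y z
  rw [J.comm (J.mul a y) (J.mul a z), J.comm y z, J.comm y, J.comm (J.mul a y) z] at h
  linear_combination (norm := module) -h

lemma pw_comm (a : E) (n : ℕ) : (∀ y, J.mul ((J.mul a ^ n) J.e) (J.mul a y)
      = J.mul a (J.mul ((J.mul a ^ n) J.e) y)) ∧
    (∀ y, J.mul ((J.mul a ^ (n+1)) J.e) (J.mul a y)
      = J.mul a (J.mul ((J.mul a ^ (n+1)) J.e) y)) := by
  induction n with
  | zero =>
    refine ⟨fun y => by simp [J.unit], fun y => ?_⟩
    simp [J.comm a J.e, J.unit]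
  | succ n ih =>
    refine ⟨ih.2, fun y => ?_⟩
    have hsq : ∀ m : ℕ, (J.mul a ^ (m+2)) J.e = J.mul (J.mul a a) ((J.mul a ^ m) J.e) := by
      intro m
      induction m with
      | zero => simp [pow_two, J.comm _ J.e, J.unit]
      | succ m ihm =>
        rw [show m + 1 + 2 = (m+2)+1 by ring, pow_succ' _ (m+2), pow_succ' _ m]
        simp only [Module.End.mul_apply]
        rw [ihm, J.jordan]
    have h1 := ih.1
    have h2 := ih.2
    rw [pow_succ'] at h2
    simp only [Module.End.mul_apply] at h2
    rw [show n + 1 + 1 = n + 2 by ring, hsq]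
    generalize (J.mul a ^ n) J.e = z at *
    rw [lsq, lsq]
    simp only [map_add, map_sub, map_smul, h1, h2, J.jordan]

lemma pw_mul (a : E) (m n : ℕ) : J.mul ((J.mul a ^ m) J.e) ((J.mul a ^ n) J.e)
    = (J.mul a ^ (m + n)) J.e := by
  induction n with
  | zero => simp [J.comm _ J.e, J.unit]
  | succ n ih =>
    rw [← add_assoc, pow_succ', pow_succ']
    simp only [Module.End.mul_apply]
    rw [(pw_comm J a m).1, ih]

open Polynomial in
lemma ev_mul (a : E) (p q : ℝ[X]) : aeval (J.mul a) (p * q) J.e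
    = J.mul (aeval (J.mul a) p J.e) (aeval (J.mul a) q J.e) := by
  induction p using Polynomial.induction_on' with
  | add p1 p2 h1 h2 => simp only [add_mul, map_add, LinearMap.add_apply, h1, h2]
  | monomial n c =>
    induction q using Polynomial.induction_on' with
    | add p1 p2 h1 h2 => simp only [mul_add, map_add, LinearMap.add_apply, h1, h2]
    | monomial m c' =>
      rw [monomial_mul_monomial]
      simp only [aeval_monomial, Module.End.mul_apply, Module.algebraMap_end_apply,
        map_smul, LinearMap.smul_apply, pw_mul, smul_smul]
      rw [mul_comm]

lemma mul_symm (a : E) : (J.mul a).IsSymmetric := fun x y => J.compat a x y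

open Polynomial in
lemma spec0 (a : E) : ∃ (s : Finset ℝ) (c : ℝ → E), (∀ μ ∈ s, J.mul (c μ) (c μ) = c μ) ∧
    (∀ μ ∈ s, ∀ ν ∈ s, μ ≠ ν → J.mul (c μ) (c ν) = 0) ∧ ∑ μ ∈ s, c μ = J.e ∧
    ∑ μ ∈ s, μ • c μ = a := by
  classical
  have hT := mul_symm J a
  set s : Finset ℝ := Finset.univ.image (hT.eigenvalues rfl) with hs
  have key : ∀ q : ℝ[X], (∀ μ ∈ s, q.eval μ = 0) → aeval (J.mul a) q = 0 := by
    intro q hq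
    apply (hT.eigenvectorBasis rfl).toBasis.ext
    intro i
    have := Module.End.aeval_apply_of_hasEigenvector (p := q) (hT.hasEigenvector_eigenvectorBasis rfl i)
    simp only [OrthonormalBasis.coe_toBasis, LinearMap.zero_apply]
    rw [this]
    have h2 := hq (hT.eigenvalues rfl i) (by simp [hs])
    simp [h2]
  have hinj : Set.InjOn (id : ℝ → ℝ) s := fun _ _ _ _ h => h
  have hev : ∀ μ ∈ s, ∀ ν ∈ s, (Lagrange.basis s id μ).eval ν = if μ = ν then 1 else 0 := by
    intro μ hμ ν hν
    split_ifs with h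
    · subst h; exact Lagrange.eval_basis_self (v := (id : ℝ → ℝ)) hinj hμ
    · exact Lagrange.eval_basis_of_ne (v := (id : ℝ → ℝ)) h hν
  refine ⟨s, fun μ => aeval (J.mul a) (Lagrange.basis s id μ) J.e, ?_, ?_, ?_, ?_⟩
  · intro μ hμ
    rw [← ev_mul, ← sub_eq_zero, ← LinearMap.sub_apply, ← map_sub, key, LinearMap.zero_apply]
    intro ν hν
    simp only [eval_sub, eval_mul, hev μ hμ ν hν]; split_ifs <;> simp
  · intro μ hμ ν hν hne
    rw [← ev_mul, key, LinearMap.zero_apply]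
    intro l hl
    simp only [eval_mul, hev μ hμ l hl, hev ν hν l hl]
    split_ifs with h1 h2 <;> simp_all
  · rw [← LinearMap.sum_apply, ← map_sum, ← sub_eq_zero]
    have : aeval (J.mul a) (∑ μ ∈ s, Lagrange.basis s id μ - 1) = 0 := by
      apply key
      intro ν hν
      simp only [eval_sub, eval_finsetSum, eval_one]
      rw [Finset.sum_congr rfl (fun μ hμ => hev μ hμ ν hν)]
      simp [hν]
    rw [map_sub, sub_eq_zero] at this
    rw [this]; simp
  · have : aeval (J.mul a) (∑ μ ∈ s, C μ * Lagrange.basis s id μ - X) = 0 := by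
      apply key
      intro ν hν
      simp only [eval_sub, eval_finsetSum, eval_X, eval_mul, eval_C]
      rw [Finset.sum_congr rfl (fun μ hμ => by rw [hev μ hμ ν hν])]
      simp [hν]
    rw [map_sub, sub_eq_zero] at this
    have h2 := congrArg (fun T => T J.e) this
    simp only [aeval_X, map_sum, map_mul, aeval_C, LinearMap.sum_apply, Module.End.mul_apply,
      Module.algebraMap_end_apply] at h2
    rw [h2, J.comm, J.unit]

lemma idem_cubic {p : E} (hp : J.mul p p = p) (y : E) :
    (3:ℝ) • J.mul p (J.mul p y) = (2:ℝ) • J.mul p (J.mul p (J.mul p y)) + J.mul p y := by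
  have h := lin2 J p p p y
  have h' := lin2 J p p y p
  simp only [hp, J.comm y p, J.comm (J.mul p y) p, J.comm y p] at h h'
  linear_combination (norm := module) h' - h

lemma idem_psd {p : E} (hp : J.mul p p = p) (y : E) :
    ⟪J.mul p y, y⟫ = ⟪J.mul p y, J.mul p y⟫ +
      4 * ⟪J.mul p y - J.mul p (J.mul p y), J.mul p y - J.mul p (J.mul p y)⟫ := by
  have h := idem_cubic J hp y
  have h4 := idem_cubic J hp (J.mul p y)
  have e1 : J.mul p (J.mul p (J.mul p y)) = (3/2:ℝ) • J.mul p (J.mul p y) - (1/2:ℝ) • J.mul p y := by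
    linear_combination (norm := module) -(1/2:ℝ) • h
  have i1 : ⟪J.mul p y, J.mul p y⟫ = ⟪y, J.mul p (J.mul p y)⟫ := J.compat _ _ _
  have i2 : ⟪J.mul p y, J.mul p (J.mul p y)⟫ = ⟪y, J.mul p (J.mul p (J.mul p y))⟫ := J.compat _ _ _
  have i3 : ⟪J.mul p (J.mul p y), J.mul p (J.mul p y)⟫
      = ⟪y, J.mul p (J.mul p (J.mul p (J.mul p y)))⟫ := by rw [J.compat, J.compat]
  have i0 : ⟪J.mul p y, y⟫ = ⟪y, J.mul p y⟫ := J.compat _ _ _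
  simp only [inner_sub_left, inner_sub_right]
  rw [real_inner_comm (J.mul p y) (J.mul p (J.mul p y)), i0, i1, i2, i3, e1]
  simp only [map_sub, map_smul, e1, inner_sub_right, inner_smul_right]
  ring

lemma idem_nonneg {p : E} (hp : J.mul p p = p) (y : E) : 0 ≤ ⟪J.mul p y, y⟫ := by
  rw [idem_psd J hp]
  have := real_inner_self_nonneg (x := J.mul p y)
  have := real_inner_self_nonneg (x := J.mul p y - J.mul p (J.mul p y))
  linarith

lemma idem_zero {p : E} (hp : J.mul p p = p) {y : E} (h : ⟪J.mul p y, y⟫ = 0) : J.mul p y = 0 := by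
  rw [idem_psd J hp] at h
  have h1 := real_inner_self_nonneg (x := J.mul p y)
  have := real_inner_self_nonneg (x := J.mul p y - J.mul p (J.mul p y))
  exact inner_self_eq_zero (𝕜 := ℝ).1 (by linarith)

lemma inner_idem {p : E} (y : E) : ⟪p, J.mul y y⟫ = ⟪J.mul p y, y⟫ := by
  rw [real_inner_comm, J.compat, J.comm y p, real_inner_comm]

lemma idem_orth {p q : E} (hp : J.mul p p = p) (hq : J.mul q q = q) (h : ⟪p, q⟫ = 0) :
    J.mul p q = 0 := by
  apply idem_zero J hp
  rw [← inner_idem, hq, h]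

lemma idem_inner_nonneg {p q : E} (hp : J.mul p p = p) (hq : J.mul q q = q) : 0 ≤ ⟪p, q⟫ := by
  rw [← hq, inner_idem]; exact idem_nonneg J hp q

lemma inner_of_orth {p q : E} (h : J.mul p q = 0) : ⟪p, q⟫ = 0 := by
  have : ⟪J.mul p J.e, q⟫ = 0 := by rw [J.compat, h, inner_zero_right]
  rwa [J.comm, J.unit] at this

lemma idem_comm {p q : E} (hp : J.mul p p = p) (hpq : J.mul p q = 0) (y : E) :
    J.mul p (J.mul q y) = J.mul q (J.mul p y) := by
  have h := lin1 J p y q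
  simpa [hp, hpq] using h

lemma half_sq {p v : E} (hp : J.mul p p = p) (hv : J.mul p v = (1/2:ℝ) • v) :
    J.mul p (J.mul p (J.mul v v)) = J.mul p (J.mul v v) := by
  have h := lin2 J p v v p
  simp only [J.comm v p, hv, hp, map_smul, LinearMap.smul_apply, J.comm (J.mul v v) p] at h
  linear_combination (norm := module) -h

/-- self-duality, easy half -/
lemma cone_inner (x z : E) : 0 ≤ ⟪J.mul x x, J.mul z z⟫ := by
  obtain ⟨s, c, h1, h2, h3, h4⟩ := spec0 J x
  have : J.mul x x = ∑ μ ∈ s, (μ*μ) • c μ := by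
    conv_lhs => rw [← h4]
    simp only [map_sum, LinearMap.sum_apply, map_smul, LinearMap.smul_apply]
    apply Finset.sum_congr rfl
    intro μ hμ
    rw [Finset.sum_eq_single μ]
    · rw [h1 μ hμ, smul_smul]
    · intro ν hν hne; rw [h2 _ hν _ hμ hne]; simp
    · intro h; exact absurd hμ h
  rw [this, sum_inner]
  refine Finset.sum_nonneg fun μ hμ => ?_
  rw [inner_smul_left, inner_idem]
  exact mul_nonneg (mul_self_nonneg μ) (idem_nonneg J (h1 μ hμ) z)

end jordan
end DC

namespace DC

section frames
variable {E : Type*} [NormedAddCommGroup E] [InnerProductSpace ℝ E] [FiniteDimensional ℝ E]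
  (J : EuclideanJordanAlgebra E)

/-- orthogonal system of nonzero idempotents diagonalizing `a` -/
def Sys (a : E) (s : Finset E) (l : E → ℝ) : Prop :=
  (∀ p ∈ s, J.mul p p = p) ∧ (∀ p ∈ s, p ≠ 0) ∧ (∀ p ∈ s, ∀ q ∈ s, p ≠ q → J.mul p q = 0) ∧
    ∑ p ∈ s, p = J.e ∧ ∑ p ∈ s, l p • p = a

lemma exists_sys (a : E) : ∃ s l, Sys J a s l := by
  classical
  obtain ⟨s, c, h1, h2, h3, h4⟩ := spec0 J a
  set s' := s.filter (fun μ => c μ ≠ 0) with hs'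
  have hinj : Set.InjOn c s' := by
    intro μ hμ ν hν h
    by_contra hne
    simp only [hs', Finset.coe_filter, Set.mem_ofPred_eq] at hμ hν
    have := h2 μ hμ.1 ν hν.1 hne
    rw [← h, h1 μ hμ.1] at this
    exact hμ.2 this
  have hl : ∀ μ ∈ s', Function.invFunOn c s' (c μ) = μ := by
    intro μ hμ
    exact hinj (Function.invFunOn_mem ⟨μ, hμ, rfl⟩) hμ (Function.invFunOn_eq ⟨μ, hμ, rfl⟩)
  refine ⟨s'.image c, Function.invFunOn c s', ?_, ?_, ?_, ?_, ?_⟩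
  · intro p hp
    obtain ⟨μ, hμ, rfl⟩ := Finset.mem_image.1 hp
    exact h1 μ (Finset.mem_filter.1 hμ).1
  · intro p hp
    obtain ⟨μ, hμ, rfl⟩ := Finset.mem_image.1 hp
    exact (Finset.mem_filter.1 hμ).2
  · intro p hp q hq hne
    obtain ⟨μ, hμ, rfl⟩ := Finset.mem_image.1 hp
    obtain ⟨ν, hν, rfl⟩ := Finset.mem_image.1 hq
    exact h2 μ (Finset.mem_filter.1 hμ).1 ν (Finset.mem_filter.1 hν).1 (fun h => hne (by rw [h]))
  · rw [Finset.sum_image hinj, ← h3, hs', Finset.sum_filter_ne_zero]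
  · rw [Finset.sum_image hinj, ← h4, Finset.sum_congr rfl (fun μ hμ => by rw [hl μ hμ])]
    rw [hs', Finset.sum_filter]
    apply Finset.sum_congr rfl
    intro μ _
    split_ifs with h
    · rfl
    · simp only [not_not] at h; rw [h, smul_zero]

lemma sys_card {a : E} {s : Finset E} {l : E → ℝ} (h : Sys J a s l) :
    s.card ≤ Module.finrank ℝ E := by
  have : LinearIndependent ℝ (fun p : s => (p : E)) := by
    apply linearIndependent_of_ne_zero_of_inner_eq_zero
    · intro p; exact h.2.1 p p.2
    · intro p q hpq
      exact inner_of_orth J (h.2.2.1 p p.2 q q.2 (fun h => hpq (Subtype.ext h)))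
  simpa using this.fintype_card_le_finrank

lemma sys_refine {a : E} {s : Finset E} {l : E → ℝ} (h : Sys J a s l) {p : E} (hp : p ∈ s)
    (hnp : ¬ J.IsPrimitive p) : ∃ s' l', Sys J a s' l' ∧ s'.card = s.card + 1 := by
  classical
  obtain ⟨h1, h2, h3, h4, h5⟩ := h
  have : ∃ q₁ q₂ : E, J.IsIdempotent q₁ ∧ J.IsIdempotent q₂ ∧ q₁ ≠ 0 ∧ q₂ ≠ 0 ∧
      J.mul q₁ q₂ = 0 ∧ p = q₁ + q₂ := by
    by_contra hc
    exact hnp ⟨h1 p hp, h2 p hp, hc⟩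
  obtain ⟨q1, q2, i1, i2, n1, n2, ho, hpq⟩ := this
  unfold EuclideanJordanAlgebra.IsIdempotent at i1 i2
  have hne : q1 ≠ q2 := by
    rintro rfl
    rw [i1] at ho; exact n1 ho
  have orth : ∀ p' ∈ s.erase p, J.mul q1 p' = 0 ∧ J.mul q2 p' = 0 := by
    intro p' hp'
    obtain ⟨hn, hs⟩ := Finset.mem_erase.1 hp'
    have h0 := inner_of_orth J (h3 p hp p' hs (Ne.symm hn))
    rw [hpq, inner_add_left] at h0
    have a1 := idem_inner_nonneg J i1 (h1 p' hs)
    have a2 := idem_inner_nonneg J i2 (h1 p' hs)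
    exact ⟨idem_orth J i1 (h1 p' hs) (by linarith), idem_orth J i2 (h1 p' hs) (by linarith)⟩
  have m1 : q1 ∉ s.erase p := fun hm => n1 (by rw [← i1]; exact (orth _ hm).1)
  have m2 : q2 ∉ s.erase p := fun hm => n2 (by rw [← i2]; exact (orth _ hm).2)
  have m1' : q1 ∉ insert q2 (s.erase p) := by
    rw [Finset.mem_insert]; exact not_or.2 ⟨hne, m1⟩
  refine ⟨insert q1 (insert q2 (s.erase p)), fun q => if q ∈ s.erase p then l q else l p,
    ⟨?_, ?_, ?_, ?_, ?_⟩, ?_⟩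
  · intro q hq
    simp only [Finset.mem_insert] at hq
    rcases hq with rfl | rfl | hq
    · exact i1
    · exact i2
    · exact h1 q (Finset.mem_erase.1 hq).2
  · intro q hq
    simp only [Finset.mem_insert] at hq
    rcases hq with rfl | rfl | hq
    · exact n1
    · exact n2
    · exact h2 q (Finset.mem_erase.1 hq).2
  · intro q hq q' hq' hqq
    simp only [Finset.mem_insert] at hq hq'
    rcases hq with rfl | rfl | hq <;> rcases hq' with rfl | rfl | hq'
    · exact absurd rfl hqq
    · exact ho
    · exact (orth _ hq').1
    · rw [J.comm]; exact ho
    · exact absurd rfl hqq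
    · exact (orth _ hq').2
    · rw [J.comm]; exact (orth _ hq).1
    · rw [J.comm]; exact (orth _ hq).2
    · exact h3 q (Finset.mem_erase.1 hq).2 q' (Finset.mem_erase.1 hq').2 hqq
  · rw [Finset.sum_insert m1', Finset.sum_insert m2, ← h4, ← Finset.add_sum_erase s _ hp,
      ← add_assoc, ← hpq]
  · rw [Finset.sum_insert m1', Finset.sum_insert m2, ← h5, ← Finset.add_sum_erase s _ hp,
      ← add_assoc]
    beta_reduce
    rw [if_neg m1, if_neg m2, ← smul_add, ← hpq]
    congr 1
    exact Finset.sum_congr rfl (fun q hq => by rw [if_pos hq])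
  · rw [Finset.card_insert_of_notMem m1', Finset.card_insert_of_notMem m2,
      Finset.card_erase_add_one hp]

lemma exists_frame (a : E) : ∃ (k : ℕ) (p : Fin k → E) (l : Fin k → ℝ), J.IsJordanFrame p ∧
    a = ∑ i, l i • p i := by
  classical
  obtain ⟨s, l, hs⟩ := exists_sys J a
  let Pk : ℕ → Prop := fun k => ∃ s l, Sys J a s l ∧ s.card = k
  have hb : ∀ k, Pk k → k ≤ Module.finrank ℝ E := by
    rintro k ⟨s, l, h, rfl⟩; exact sys_card J h
  have hP : Pk s.card := ⟨s, l, hs, rfl⟩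
  have hmax := Nat.findGreatest_spec (P := Pk) (hb _ hP) hP
  obtain ⟨s', l', h', hc⟩ := hmax
  have hprim : ∀ p ∈ s', J.IsPrimitive p := by
    intro p hp
    by_contra hn
    obtain ⟨s2, l2, hs2, hc2⟩ := sys_refine J h' hp hn
    have hP2 : Pk s2.card := ⟨s2, l2, hs2, rfl⟩
    have := Nat.le_findGreatest (hb _ hP2) hP2
    omega
  refine ⟨s'.card, fun i => (s'.equivFin.symm i : E), fun i => l' (s'.equivFin.symm i : E),
    ⟨?_, ?_, ?_⟩, ?_⟩
  · intro i; exact hprim _ (s'.equivFin.symm i).2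
  · intro i j hij
    exact h'.2.2.1 _ (s'.equivFin.symm i).2 _ (s'.equivFin.symm j).2
      (fun h => hij (s'.equivFin.symm.injective (Subtype.ext h)))
  · rw [← h'.2.2.2.1, ← Finset.sum_coe_sort s']
    exact Equiv.sum_comp s'.equivFin.symm (fun q : s' => (q : E))
  · rw [← h'.2.2.2.2, ← Finset.sum_coe_sort s']
    exact (Equiv.sum_comp s'.equivFin.symm (fun q : s' => l' (q : E) • (q : E))).symm

lemma compl_idem {p : E} (hp : J.mul p p = p) : J.mul (J.e - p) (J.e - p) = J.e - p := by
  simp only [map_sub, LinearMap.sub_apply, J.unit, J.comm p J.e, hp]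
  abel

/-- `V_1(p) = ℝ p` for primitive `p` -/
lemma prim_one {p : E} (hp : J.IsPrimitive p) {x : E} (hx : J.mul p x = x) :
    ∃ c : ℝ, x = c • p := by
  classical
  obtain ⟨hpi, hp0, hpn⟩ := hp
  unfold EuclideanJordanAlgebra.IsIdempotent at hpi
  obtain ⟨s, l, h1, h2, h3, h4, h5⟩ := exists_sys J x
  have hq := compl_idem J hpi
  have hxx : ⟪J.e - p, J.mul x x⟫ = 0 := by
    rw [inner_idem]
    simp [J.unit, hx]
  have hsq : J.mul x x = ∑ q ∈ s, (l q * l q) • q := by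
    conv_lhs => rw [← h5]
    simp only [map_sum, LinearMap.sum_apply, map_smul, LinearMap.smul_apply]
    apply Finset.sum_congr rfl
    intro μ hμ
    rw [Finset.sum_eq_single μ]
    · rw [h1 μ hμ, smul_smul]
    · intro ν hν hne; rw [h3 _ hν _ hμ hne]; simp
    · intro h; exact absurd hμ h
  rw [hsq, inner_sum] at hxx
  have hz := (Finset.sum_eq_zero_iff_of_nonneg (fun q hqs => by
    rw [inner_smul_right]
    exact mul_nonneg (mul_self_nonneg _) (idem_inner_nonneg J hq (h1 q hqs)))).1 hxx
  have hall : ∀ q ∈ s, l q ≠ 0 → q = p := by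
    intro q hqs hl
    have hzq := hz q hqs
    rw [inner_smul_right] at hzq
    have h0 : ⟪J.e - p, q⟫ = 0 := by
      rcases mul_eq_zero.1 hzq with h | h
      · exact absurd (mul_self_eq_zero.1 h) hl
      · exact h
    have := idem_orth J hq (h1 q hqs) h0
    rw [map_sub, LinearMap.sub_apply, J.unit, sub_eq_zero] at this
    by_contra hne
    apply hpn
    refine ⟨q, p - q, h1 q hqs, ?_, h2 q hqs, sub_ne_zero.2 (Ne.symm hne), ?_, by abel⟩
    · unfold EuclideanJordanAlgebra.IsIdempotent
      simp only [map_sub, LinearMap.sub_apply, hpi, J.comm q p, ← this, h1 q hqs]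
      abel
    · rw [map_sub, h1 q hqs, J.comm, ← this, sub_self]
  refine ⟨∑ q ∈ s, l q, ?_⟩
  conv_lhs => rw [← h5]
  rw [Finset.sum_smul]
  apply Finset.sum_congr rfl
  intro q hqs
  by_cases hl : l q = 0
  · simp [hl]
  · rw [hall q hqs hl]

variable {k : ℕ} {p : Fin k → E}

/-- the Peirce one-half space -/
noncomputable def half (p : E) : Submodule ℝ E :=
  LinearMap.ker (J.mul p - (1/2 : ℝ) • LinearMap.id)

lemma mem_half {p v : E} : v ∈ half J p ↔ J.mul p v = (1/2:ℝ) • v := by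
  simp [half, sub_eq_zero]

lemma mem_peirce {p q v : E} : v ∈ J.peirceSpace p q ↔
    J.mul p v = (1/2:ℝ) • v ∧ J.mul q v = (1/2:ℝ) • v := by
  simp [EuclideanJordanAlgebra.peirceSpace, sub_eq_zero]

lemma frame_sum (hp : J.IsJordanFrame p) (v : E) : ∑ i, J.mul (p i) v = v := by
  rw [← LinearMap.sum_apply, ← map_sum, hp.2.2, J.unit]

lemma peirce_kill (hp : J.IsJordanFrame p) {a b j : Fin k} (hab : a ≠ b) (hja : j ≠ a)
    (hjb : j ≠ b) {w : E} (hw : w ∈ J.peirceSpace (p a) (p b)) : J.mul (p j) w = 0 := by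
  classical
  obtain ⟨wa, wb⟩ := (mem_peirce J).1 hw
  apply idem_zero J (hp.1 j).1
  have h := frame_sum J hp w
  have h2 : ∑ i, ⟪J.mul (p i) w, w⟫ = ⟪w, w⟫ := by rw [← sum_inner, h]
  rw [← Finset.add_sum_erase _ _ (Finset.mem_univ a),
    ← Finset.add_sum_erase (Finset.univ.erase a) _ (Finset.mem_erase.2 ⟨hab.symm, Finset.mem_univ b⟩),
    wa, wb, inner_smul_left] at h2
  simp only [RCLike.conj_to_real] at h2
  have h3 : ∑ i ∈ (Finset.univ.erase a).erase b, ⟪J.mul (p i) w, w⟫ = 0 := by linarith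
  exact (Finset.sum_eq_zero_iff_of_nonneg (fun i _ => idem_nonneg J (hp.1 i).1 w)).1 h3 j
    (by simp [hja, hjb])

lemma half_peirce (hp : J.IsJordanFrame p) {a j : Fin k} (hja : j ≠ a) {v : E}
    (hv : v ∈ half J (p a)) : J.mul (p j) v ∈ J.peirceSpace (p a) (p j) := by
  classical
  rw [mem_half] at hv
  have hcomm := fun y => idem_comm J (hp.1 a).1 (hp.2.1 a j hja.symm) y
  have hc := idem_cubic J (hp.1 j).1 v
  set u := (2:ℝ) • J.mul (p j) (J.mul (p j) v) - J.mul (p j) v with hu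
  have hu1 : J.mul (p j) u = u := by
    simp only [hu, map_sub, map_smul]
    linear_combination (norm := module) -hc
  have hua : J.mul (p a) u = (1/2:ℝ) • u := by
    simp only [hu, map_sub, map_smul, hcomm, hv]
    module
  have h2 : ∑ i, ⟪J.mul (p i) u, u⟫ = ⟪u, u⟫ := by rw [← sum_inner, frame_sum J hp]
  rw [← Finset.add_sum_erase _ _ (Finset.mem_univ j), hu1] at h2
  have h3 : ∑ i ∈ Finset.univ.erase j, ⟪J.mul (p i) u, u⟫ = 0 := by linarith
  have h4 := (Finset.sum_eq_zero_iff_of_nonneg (fun i _ => idem_nonneg J (hp.1 i).1 u)).1 h3 a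
    (by simp [hja.symm])
  rw [hua, inner_smul_left] at h4
  have h5 : u = 0 := by
    have : ⟪u, u⟫ = 0 := by
      simp only [RCLike.conj_to_real] at h4
      linarith
    exact inner_self_eq_zero (𝕜 := ℝ).1 this
  rw [mem_peirce]
  constructor
  · rw [hcomm, hv, map_smul]
  · rw [hu] at h5
    linear_combination (norm := module) (1/2:ℝ) • h5

lemma finrank_half (hp : J.IsJordanFrame p) (a : Fin k) {d : ℕ}
    (hd : J.HasPeirceInvariant d) :
    (Module.finrank ℝ (half J (p a)) : ℝ) = (d:ℝ) * ((k:ℝ) - 1) := by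
  classical
  let f : half J (p a) →ₗ[ℝ] ((j : {j : Fin k // j ≠ a}) → J.peirceSpace (p a) (p j)) :=
    LinearMap.pi (fun j => LinearMap.codRestrict _
      (((2:ℝ) • J.mul (p j)) ∘ₗ (half J (p a)).subtype)
      (fun v => Submodule.smul_mem _ _ (half_peirce J hp j.2 v.2)))
  let g : ((j : {j : Fin k // j ≠ a}) → J.peirceSpace (p a) (p j)) → half J (p a) :=
    fun w => ⟨∑ j, (w j : E), Submodule.sum_mem _ (fun j _ =>
      (mem_half J).2 ((mem_peirce J).1 (w j).2).1)⟩
  have hbij : Function.Bijective f := by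
    refine Function.bijective_iff_has_inverse.2 ⟨g, ?_, ?_⟩
    · intro v
      apply Subtype.ext
      change ∑ j : {j : Fin k // j ≠ a}, (2:ℝ) • J.mul (p j) (v:E) = v
      have hv := (mem_half J).1 v.2
      have hs := frame_sum J hp (v:E)
      rw [← Finset.add_sum_erase _ _ (Finset.mem_univ a), hv] at hs
      rw [← Finset.smul_sum, ← Finset.sum_subtype (Finset.univ.erase a) (by simp)
        (fun j => J.mul (p j) (v:E))]
      linear_combination (norm := module) (2:ℝ) • hs
    · intro w
      funext j
      apply Subtype.ext
      change (2:ℝ) • J.mul (p j) (∑ l, (w l : E)) = w j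
      rw [map_sum, Finset.sum_eq_single j]
      · rw [((mem_peirce J).1 (w j).2).2]; module
      · intro l _ hl
        exact peirce_kill J hp (Ne.symm l.2) j.2 (fun h => hl (Subtype.ext h.symm)) (w l).2
      · intro h; exact absurd (Finset.mem_univ j) h
  have h1 := (LinearEquiv.ofBijective f hbij).finrank_eq
  rw [Module.finrank_pi_fintype, Finset.sum_congr rfl
    (fun (j : {j : Fin k // j ≠ a}) _ => hd k p hp a j (Ne.symm j.2))] at h1
  have hk : 1 ≤ k := Fin.pos a
  rw [h1]
  simp [Fintype.card_subtype_compl, Nat.cast_sub hk, mul_comm]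

end frames
end DC

namespace DC

section analysis
variable {E : Type*} [NormedAddCommGroup E] [InnerProductSpace ℝ E] [FiniteDimensional ℝ E]
  [MeasurableSpace E] [BorelSpace E]

lemma one_sub_exp_bound {s N : ℝ} (hs : 0 ≤ s) (hN : 1 ≤ N) :
    |(Real.exp (-(N * s)) - 1) / N| ≤ min s 1 := by
  have hN0 : 0 < N := by linarith
  have h1 : Real.exp (-(N*s)) ≤ 1 := Real.exp_le_one_iff.2 (by nlinarith)
  have h2 := Real.add_one_le_exp (-(N*s))
  have h3 := Real.exp_pos (-(N*s))
  rw [abs_div, abs_of_nonpos (by linarith), abs_of_pos hN0, le_min_iff, div_le_iff₀ hN0,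
    div_le_iff₀ hN0]
  constructor <;> nlinarith

lemma limF {K : Set E} {F : E → ℝ} (PF : FParams K F) {u : E} (hu : u ∈ dualCone K)
    (hsm : ∀ c : ℝ, 0 ≤ c → c • u ∈ dualCone K) :
    Tendsto (fun N : ℝ => F (N • u) / N) atTop (𝓝 ⟪PF.b, u⟫) := by
  have hI : Tendsto (fun N : ℝ => ∫ ξ, (Real.exp (-(N * ⟪u, ξ⟫)) - 1) / N ∂PF.m) atTop
      (𝓝 (∫ ξ, (0:ℝ) ∂PF.m)) := by
    have hsupp : ∀ᵐ ξ ∂PF.m, ξ ∈ K := PF.m_supp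
    refine tendsto_integral_filter_of_dominated_convergence
      (fun ξ => (‖u‖ + 1) * min ‖ξ‖ 1) ?_ ?_ ?_ ?_
    · refine Eventually.of_forall fun N => Continuous.aestronglyMeasurable ?_
      fun_prop
    · filter_upwards [eventually_ge_atTop (1:ℝ)] with N hN
      filter_upwards [hsupp] with ξ hξ
      have hs : 0 ≤ ⟪u, ξ⟫ := by rw [real_inner_comm]; exact hu ξ hξ
      rw [Real.norm_eq_abs]
      refine (one_sub_exp_bound hs hN).trans ?_
      have h1 := real_inner_le_norm u ξ
      have hu0 := norm_nonneg u
      have hx0 := norm_nonneg ξ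
      rcases le_total ‖ξ‖ 1 with h | h
      · rw [min_eq_left h]; exact (min_le_left _ _).trans (by nlinarith)
      · rw [min_eq_right h]; exact (min_le_right _ _).trans (by nlinarith)
    · refine Integrable.const_mul ?_ _
      refine ⟨Continuous.aestronglyMeasurable (by fun_prop), ?_⟩
      rw [hasFiniteIntegral_iff_ofReal (Eventually.of_forall fun ξ => by positivity)]
      exact PF.m_int
    · filter_upwards [hsupp] with ξ hξ
      have hs : 0 ≤ ⟪u, ξ⟫ := by rw [real_inner_comm]; exact hu ξ hξ
      have h0 : Tendsto (fun N : ℝ => 1 / N) atTop (𝓝 0) := by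
        simpa using tendsto_inv_atTop_zero (𝕜 := ℝ)
      refine squeeze_zero_norm' ?_ h0
      filter_upwards [eventually_ge_atTop (1:ℝ)] with N hN
      have hN0 : 0 < N := by linarith
      have h1 : Real.exp (-(N*⟪u, ξ⟫)) ≤ 1 := Real.exp_le_one_iff.2 (by nlinarith)
      have h3 := Real.exp_pos (-(N*⟪u, ξ⟫))
      rw [Real.norm_eq_abs, abs_div, abs_of_nonpos (by linarith), abs_of_pos hN0]
      gcongr
      linarith
  have hc : Tendsto (fun N : ℝ => PF.c / N) atTop (𝓝 0) :=
    tendsto_const_nhds.div_atTop tendsto_id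
  have := ((tendsto_const_nhds (x := ⟪PF.b, u⟫)).add hc).sub hI
  simp only [integral_zero, add_zero, sub_zero] at this
  refine this.congr' ?_
  filter_upwards [eventually_gt_atTop (0:ℝ)] with N hN
  rw [PF.eq _ (hsm N hN.le), integral_div]
  simp only [inner_smul_left, inner_smul_right, RCLike.conj_to_real]
  field_simp

lemma exp_second_bound {s : ℝ} (hs : 0 ≤ s) : |Real.exp (-s) - 1 + s| ≤ s ^ 2 := by
  have h2 := Real.add_one_le_exp (-s)
  rw [abs_of_nonneg (by linarith)]
  rcases le_total s 1 with h | h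
  · have := Real.abs_exp_sub_one_sub_id_le (x := -s) (by rw [abs_neg, abs_of_nonneg hs]; exact h)
    have := (abs_le.1 this).2
    nlinarith
  · have : Real.exp (-s) ≤ 1 := Real.exp_le_one_iff.2 (by linarith)
    nlinarith

lemma limR {K : Set E} {χ : E → E} (hχ : IsTruncation χ) {R : E → E} (PR : RParams K χ R)
    {u x : E} (hu : u ∈ dualCone K) (hx : x ∈ K)
    (hsm : ∀ c : ℝ, 0 ≤ c → c • u ∈ dualCone K) :
    Tendsto (fun N : ℝ => ⟪R (N • u), x⟫ / N ^ 2) atTop (𝓝 (-(1/2) * ⟪PR.Q u u, x⟫)) := by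
  obtain ⟨hχc, hχb, hχ0⟩ := hχ
  obtain ⟨δ, hδ, hball⟩ := Metric.eventually_nhds_iff.1 hχ0
  have hI : Tendsto (fun N : ℝ => ∫ ξ, (Real.exp (-(N * ⟪u, ξ⟫)) - 1 + N * ⟪χ ξ, u⟫) / N ^ 2
      ∂(PR.M x)) atTop (𝓝 (∫ ξ, (0:ℝ) ∂(PR.M x))) := by
    have hsupp : ∀ᵐ ξ ∂(PR.M x), ξ ∈ K := PR.M_supp x hx
    have hgen : ∀ N : ℝ, 1 ≤ N → ∀ ξ ∈ K,
        |(Real.exp (-(N * ⟪u, ξ⟫)) - 1 + N * ⟪χ ξ, u⟫) / N ^ 2| ≤ (1 + ‖u‖) / N := by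
      intro N hN ξ hξ
      have hs : 0 ≤ ⟪u, ξ⟫ := by rw [real_inner_comm]; exact hu ξ hξ
      have hN0 : 0 < N := by linarith
      have h1 : Real.exp (-(N*⟪u, ξ⟫)) ≤ 1 := Real.exp_le_one_iff.2 (by nlinarith)
      have h3 := Real.exp_pos (-(N*⟪u, ξ⟫))
      have h4 : |⟪χ ξ, u⟫| ≤ ‖u‖ := (abs_real_inner_le_norm _ _).trans (by
        have := hχb ξ; have := norm_nonneg u; nlinarith)
      rw [abs_div, abs_of_pos (by positivity : 0 < N^2), div_le_div_iff₀ (by positivity) hN0]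
      have h5 : |Real.exp (-(N * ⟪u, ξ⟫)) - 1 + N * ⟪χ ξ, u⟫| ≤ 1 + N * ‖u‖ := by
        refine (abs_add_le _ _).trans (add_le_add ?_ ?_)
        · rw [abs_le]; constructor <;> linarith
        · rw [abs_mul, abs_of_pos hN0]; gcongr
      have h6 : 1 + N * ‖u‖ ≤ N * (1 + ‖u‖) := by linarith
      calc _ ≤ (N * (1 + ‖u‖)) * N := by gcongr; exact h5.trans h6
        _ = _ := by ring
    refine tendsto_integral_filter_of_dominated_convergence
      (fun ξ => (‖u‖ ^ 2 + (1 + ‖u‖) / min (δ ^ 2) 1) * min (‖ξ‖ ^ 2) 1) ?_ ?_ ?_ ?_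
    · refine Eventually.of_forall fun N => Continuous.aestronglyMeasurable ?_
      fun_prop
    · filter_upwards [eventually_ge_atTop (1:ℝ)] with N hN
      filter_upwards [hsupp] with ξ hξ
      have hs : 0 ≤ ⟪u, ξ⟫ := by rw [real_inner_comm]; exact hu ξ hξ
      have hN0 : 0 < N := by linarith
      have hg := hgen N hN ξ hξ
      have hg' : (1 + ‖u‖) / N ≤ 1 + ‖u‖ := div_le_self (by positivity) hN
      rw [Real.norm_eq_abs]
      have hm : 0 < min (δ^2) 1 := by positivity
      by_cases hlt : ‖ξ‖ < δ ∧ ‖ξ‖ ≤ 1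
      · have hxi : χ ξ = ξ := hball (by simpa using hlt.1)
        have h1 := exp_second_bound (s := N * ⟪u, ξ⟫) (by positivity)
        rw [hxi, real_inner_comm u ξ] at *
        rw [abs_div, abs_of_pos (by positivity : 0 < N^2), div_le_iff₀ (by positivity)]
        have h2 : ⟪u, ξ⟫ ^ 2 ≤ ‖u‖ ^ 2 * ‖ξ‖ ^ 2 := by
          rw [← mul_pow]; exact pow_le_pow_left₀ hs (real_inner_le_norm _ _) 2
        have h3 : min (‖ξ‖^2) 1 = ‖ξ‖^2 := min_eq_left (pow_le_one₀ (norm_nonneg _) hlt.2)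
        rw [h3]
        have h4 : 0 ≤ (1 + ‖u‖) / min (δ ^ 2) 1 * ‖ξ‖ ^ 2 := by positivity
        calc _ ≤ (N * ⟪u, ξ⟫)^2 := h1
          _ = ⟪u, ξ⟫^2 * N^2 := by ring
          _ ≤ _ := by gcongr; linarith
      · have hge : min (δ^2) 1 ≤ min (‖ξ‖^2) 1 := by
          by_cases h1 : ‖ξ‖ ≤ 1
          · have h2 : δ ≤ ‖ξ‖ := by
              by_contra hc; exact hlt ⟨not_le.1 hc, h1⟩
            exact min_le_min (pow_le_pow_left₀ hδ.le h2 2) le_rfl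
          · have : (1:ℝ) ≤ ‖ξ‖^2 := one_le_pow₀ (not_le.1 h1).le
            rw [min_eq_right this]; exact min_le_right _ _
        refine (hg.trans hg').trans ?_
        calc 1 + ‖u‖ = (1 + ‖u‖) / min (δ ^ 2) 1 * min (δ^2) 1 := by field_simp
          _ ≤ (1 + ‖u‖) / min (δ ^ 2) 1 * min (‖ξ‖^2) 1 := by gcongr
          _ ≤ _ := by gcongr; nlinarith [sq_nonneg ‖u‖]
    · refine Integrable.const_mul ?_ _
      refine ⟨Continuous.aestronglyMeasurable (by fun_prop), ?_⟩
      rw [hasFiniteIntegral_iff_ofReal (Eventually.of_forall fun ξ => by positivity)]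
      exact PR.M_int x hx
    · filter_upwards [hsupp] with ξ hξ
      have h0 : Tendsto (fun N : ℝ => (1 + ‖u‖) / N) atTop (𝓝 0) :=
        tendsto_const_nhds.div_atTop tendsto_id
      refine squeeze_zero_norm' ?_ h0
      filter_upwards [eventually_ge_atTop (1:ℝ)] with N hN
      exact hgen N hN ξ hξ
  have hc1 : Tendsto (fun N : ℝ => ⟪PR.B u, x⟫ / N) atTop (𝓝 0) :=
    tendsto_const_nhds.div_atTop tendsto_id
  have hc2 : Tendsto (fun N : ℝ => ⟪PR.γ, x⟫ / N ^ 2) atTop (𝓝 0) :=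
    tendsto_const_nhds.div_atTop (tendsto_pow_atTop two_ne_zero)
  have := (((tendsto_const_nhds (x := -(1/2) * ⟪PR.Q u u, x⟫)).add hc1).add hc2).sub hI
  simp only [integral_zero, add_zero, sub_zero] at this
  refine this.congr' ?_
  filter_upwards [eventually_gt_atTop (0:ℝ)] with N hN
  rw [PR.eq _ (hsm N hN.le) x hx, integral_div]
  simp only [inner_smul_left, inner_smul_right, RCLike.conj_to_real, map_smul,
    LinearMap.smul_apply]
  field_simp

end analysis
end DC

namespace DC

section pmp
variable {E : Type*} [NormedAddCommGroup E] [InnerProductSpace ℝ E] [FiniteDimensional ℝ E]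
  [MeasurableSpace E] [BorelSpace E]

/-- exponentials -/
noncomputable def eu (u : E) : E → ℝ := fun x => Real.exp (-⟪u, x⟫)

/-- span of the exponentials -/
def Espan (K : Set E) : Submodule ℝ (E → ℝ) := Submodule.span ℝ (eu '' dualCone K)

/-- discrete approximation of the generator at `x0` -/
noncomputable def Tgen {n : ℕ} (x0 b : E) (w : Fin n → E) (lam : Fin n → ℝ) (f : E → ℝ) (s : ℝ) :
    ℝ :=
  (f (x0 + s • b) - f x0) / s
    + (1/2) * ∑ j, lam j * ((f (x0 + s • w j) + f (x0 - s • w j) - 2 * f x0) / s ^ 2)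

lemma Tgen_add {n : ℕ} (x0 b : E) (w : Fin n → E) (lam : Fin n → ℝ) (f g : E → ℝ) (s : ℝ) :
    Tgen x0 b w lam (f + g) s = Tgen x0 b w lam f s + Tgen x0 b w lam g s := by
  simp only [Tgen, Pi.add_apply]
  have : ∀ j, lam j * ((f (x0 + s • w j) + g (x0 + s • w j) + (f (x0 - s • w j) + g (x0 - s • w j))
      - 2 * (f x0 + g x0)) / s ^ 2) = lam j * ((f (x0 + s • w j) + f (x0 - s • w j)
      - 2 * f x0) / s ^ 2) + lam j * ((g (x0 + s • w j) + g (x0 - s • w j)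
      - 2 * g x0) / s ^ 2) := fun j => by ring
  simp only [this, Finset.sum_add_distrib]
  ring

lemma Tgen_smul {n : ℕ} (x0 b : E) (w : Fin n → E) (lam : Fin n → ℝ) (c : ℝ) (f : E → ℝ) (s : ℝ) :
    Tgen x0 b w lam (c • f) s = c * Tgen x0 b w lam f s := by
  simp only [Tgen, Pi.smul_apply, smul_eq_mul]
  have : ∀ j, lam j * ((c * f (x0 + s • w j) + c * f (x0 - s • w j)
      - 2 * (c * f x0)) / s ^ 2) = c * (lam j * ((f (x0 + s • w j) + f (x0 - s • w j)
      - 2 * f x0) / s ^ 2)) := fun j => by ring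
  simp only [this, ← Finset.mul_sum]
  ring

lemma exp_slope (a : ℝ) : Tendsto (fun s : ℝ => (Real.exp (s * a) - 1) / s) (𝓝[>] 0) (𝓝 a) := by
  have h : HasDerivAt (fun s : ℝ => Real.exp (s * a)) a 0 := by
    have := ((hasDerivAt_id (0:ℝ)).mul_const a).exp
    simpa using this
  have h2 := (hasDerivAt_iff_tendsto_slope.1 h).mono_left
    (nhdsWithin_mono 0 (fun x (hx : 0 < x) => ne_of_gt hx))
  refine h2.congr (fun s => ?_)
  simp [slope_def_field]

lemma exp_second (a : ℝ) : Tendsto (fun s : ℝ => (Real.exp (s * a) + Real.exp (-(s * a)) - 2) / s^2)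
    (𝓝[>] 0) (𝓝 (a ^ 2)) := by
  have h := ((exp_slope (a/2)).sub (exp_slope (-(a/2)))).pow 2
  rw [show a/2 - -(a/2) = a by ring] at h
  refine h.congr (fun s => ?_)
  rw [← sub_div, div_pow]
  congr 1
  have e1 : Real.exp (s * a) = Real.exp (s * (a/2)) ^ 2 := by
    rw [← Real.exp_nat_mul]; congr 1; push_cast; ring
  have e2 : Real.exp (-(s * a)) = Real.exp (s * (-(a/2))) ^ 2 := by
    rw [← Real.exp_nat_mul]; congr 1; push_cast; ring
  have e3 : Real.exp (s * (a/2)) * Real.exp (s * (-(a/2))) = 1 := by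
    rw [← Real.exp_add]; simp
  rw [e1, e2]
  linear_combination -2 * e3

lemma Tgen_eu {n : ℕ} (x0 b : E) (w : Fin n → E) (lam : Fin n → ℝ) (u : E) :
    Tendsto (Tgen x0 b w lam (eu u)) (𝓝[>] 0)
      (𝓝 (eu u x0 * (-⟪u, b⟫ + (1/2) * ∑ j, lam j * ⟪u, w j⟫ ^ 2))) := by
  have h1 := exp_slope (-⟪u, b⟫)
  have h2 := fun j => (exp_second (-⟪u, w j⟫)).const_mul (lam j)
  have h3 := (h1.add ((tendsto_finsetSum Finset.univ (fun j _ => h2 j)).const_mul (1/2:ℝ))).const_mul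
    (eu u x0)
  simp only [neg_sq] at h3
  refine h3.congr (fun s => ?_)
  have e1 : ∀ y, eu u (x0 + y) = eu u x0 * Real.exp (-⟪u, y⟫) := by
    intro y; simp only [eu]; rw [← Real.exp_add, inner_add_right]; congr 1; ring
  simp only [Tgen, sub_eq_add_neg x0, e1, inner_smul_right, inner_neg_right]
  rw [mul_add, mul_left_comm, Finset.mul_sum]
  simp only [mul_neg, neg_neg]
  congr 1
  · ring
  · congr 1
    apply Finset.sum_congr rfl
    intro j _
    ring

lemma pmp {K : Set E} {φ : ℝ → E → ℝ} {ψ : ℝ → E → E} (X : AffineTransitionFamily K φ ψ)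
    (hK : ∀ c : ℝ, 0 ≤ c → ∀ x ∈ K, c • x ∈ K)
    {χ : E → E} (hχ : IsTruncation χ)
    {F : E → ℝ} {R : E → E}
    (hF : ∀ u ∈ dualCone K, HasDerivWithinAt (fun t => φ t u) (F u) (Set.Ici (0 : ℝ)) 0)
    (hR : ∀ u ∈ dualCone K, HasDerivWithinAt (fun t => ψ t u) (R u) (Set.Ici (0 : ℝ)) 0)
    (PF : FParams K F) (PR : RParams K χ R) {x0 : E} (hx0 : x0 ∈ K)
    {n : ℕ} (w : Fin n → E) (lam : Fin n → ℝ)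
    (hq : ∀ u, ⟪PR.Q u u, x0⟫ = ∑ j, lam j * ⟪u, w j⟫ ^ 2)
    {f : E → ℝ} (hf : f ∈ Espan K) (hpos : ∀ x ∈ K, 0 ≤ f x) (hf0 : f x0 = 0) {a : ℝ}
    (ha : Tendsto (Tgen x0 PF.b w lam f) (𝓝[>] 0) (𝓝 a)) : 0 ≤ a := by
  have hsm : ∀ u ∈ dualCone K, ∀ c : ℝ, 0 ≤ c → c • u ∈ dualCone K := by
    intro u hu c hc x hx
    rw [inner_smul_right]
    exact mul_nonneg hc (hu x hx)
  have hfin : ∀ t : ℝ, 0 ≤ t → ∀ x ∈ K, IsFiniteMeasure (X.p t x) := fun t ht x hx =>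
    ⟨(X.subprob t ht x hx).trans_lt ENNReal.one_lt_top⟩
  have hxN : ∀ N : ℝ, 0 < N → N⁻¹ • x0 ∈ K := fun N hN => hK _ (inv_nonneg.2 hN.le) _ hx0
  have key : ∃ (a : ℝ) (D : ℝ → ℝ),
      (∀ N : ℝ, 0 < N → ∀ t : ℝ, 0 ≤ t →
        Integrable (fun ξ => f (N • ξ)) (X.p t (N⁻¹ • x0))) ∧
      (∀ N : ℝ, 0 < N → HasDerivWithinAt (fun t => ∫ ξ, f (N • ξ) ∂(X.p t (N⁻¹ • x0)))
        (D N) (Set.Ici (0:ℝ)) 0) ∧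
      Tendsto (fun N => D N / N) atTop (𝓝 a) ∧
      Tendsto (Tgen x0 PF.b w lam f) (𝓝[>] 0) (𝓝 a) ∧ Continuous f := by
    clear ha hf0 hpos
    induction hf using Submodule.span_induction with
    | mem f hf =>
      obtain ⟨u, hu, rfl⟩ := hf
      have hlap : ∀ N : ℝ, 0 < N → ∀ t : ℝ, 0 ≤ t →
          ∫ ξ, eu u (N • ξ) ∂(X.p t (N⁻¹ • x0))
            = Real.exp (-(φ t (N • u)) - ⟪ψ t (N • u), N⁻¹ • x0⟫) := by
        intro N hN t ht
        rw [← X.laplace t ht _ (hsm u hu N hN.le) _ (hxN N hN)]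
        simp only [eu, inner_smul_left, inner_smul_right, RCLike.conj_to_real]
      refine ⟨eu u x0 * (-⟪u, PF.b⟫ + (1/2) * ∑ j, lam j * ⟪u, w j⟫ ^ 2),
        fun N => eu u x0 * (-(F (N • u)) - ⟪R (N • u), N⁻¹ • x0⟫), ?_, ?_, ?_, ?_, ?_⟩
      · intro N hN t ht
        have := hfin t ht _ (hxN N hN)
        refine Integrable.of_bound (C := 1) (Continuous.aestronglyMeasurable ?_) ?_
        · unfold eu; fun_prop
        · have hsupp : ∀ᵐ ξ ∂(X.p t (N⁻¹ • x0)), ξ ∈ K := X.supported t ht _ (hxN N hN)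
          filter_upwards [hsupp] with ξ hξ
          simp only [eu, Real.norm_eq_abs, Real.abs_exp, Real.exp_le_one_iff, Left.neg_nonpos_iff]
          rw [real_inner_comm]
          exact hu _ (hK N hN.le _ hξ)
      · intro N hN
        have h1 := hF _ (hsm u hu N hN.le)
        have h2 := (hR _ (hsm u hu N hN.le)).inner ℝ
          (hasDerivWithinAt_const (0:ℝ) (Set.Ici (0:ℝ)) (N⁻¹ • x0))
        have h3 := (h1.neg.sub h2).exp
        have hv0 := hlap N hN 0 le_rfl
        rw [X.init _ (hxN N hN), integral_dirac, smul_inv_smul₀ hN.ne'] at hv0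
        have h4 := h3.congr (f₁ := fun t => ∫ ξ, eu u (N • ξ) ∂(X.p t (N⁻¹ • x0)))
          (fun t ht => hlap N hN t ht) (hlap N hN 0 le_rfl)
        refine h4.congr_deriv ?_
        rw [hv0]
        simp
      · have h1 := limF PF hu (hsm u hu)
        have h2 := limR hχ PR hu hx0 (hsm u hu)
        have h3 := ((h1.neg.sub h2).const_mul (eu u x0))
        rw [hq, real_inner_comm] at h3
        have h4 : -⟪u, PF.b⟫ - -(1/2) * ∑ j, lam j * ⟪u, w j⟫ ^ 2
            = -⟪u, PF.b⟫ + (1/2) * ∑ j, lam j * ⟪u, w j⟫ ^ 2 := by ring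
        rw [h4] at h3
        refine h3.congr' ?_
        filter_upwards [eventually_gt_atTop (0:ℝ)] with N hN
        rw [inner_smul_right]
        field_simp
      · exact Tgen_eu _ _ _ _ _
      · unfold eu; fun_prop
    | zero =>
      refine ⟨0, 0, ?_, ?_, ?_, ?_, ?_⟩
      · intro N hN t ht; simp
      · intro N hN
        simpa using hasDerivWithinAt_const (0:ℝ) (Set.Ici (0:ℝ)) (0:ℝ)
      · simp
      · have : Tgen x0 PF.b w lam (0 : E → ℝ) = fun _ => 0 := by
          funext s; simp [Tgen]
        rw [this]; exact tendsto_const_nhds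
      · exact continuous_zero
    | add f g _ _ hf hg =>
      obtain ⟨a1, D1, i1, d1, t1, g1, c1⟩ := hf
      obtain ⟨a2, D2, i2, d2, t2, g2, c2⟩ := hg
      refine ⟨a1 + a2, fun N => D1 N + D2 N, ?_, ?_, ?_, ?_, c1.add c2⟩
      · intro N hN t ht; exact (i1 N hN t ht).add (i2 N hN t ht)
      · intro N hN
        refine ((d1 N hN).add (d2 N hN)).congr (fun t ht => ?_) ?_
        · simp only [Pi.add_apply]
          rw [integral_add (i1 N hN t ht) (i2 N hN t ht)]
        · simp only [Pi.add_apply]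
          rw [integral_add (i1 N hN 0 le_rfl) (i2 N hN 0 le_rfl)]
      · simpa only [add_div] using t1.add t2
      · exact (g1.add g2).congr (fun s => (Tgen_add _ _ _ _ _ _ _).symm)
    | smul c f _ hf =>
      obtain ⟨a1, D1, i1, d1, t1, g1, c1⟩ := hf
      refine ⟨c * a1, fun N => c * D1 N, ?_, ?_, ?_, ?_, c1.const_smul c⟩
      · intro N hN t ht; exact (i1 N hN t ht).const_mul c
      · intro N hN
        refine ((d1 N hN).const_mul c).congr (fun t ht => ?_) ?_
        · simp only [Pi.smul_apply, smul_eq_mul, integral_const_mul]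
        · simp only [Pi.smul_apply, smul_eq_mul, integral_const_mul]
      · simpa only [mul_div_assoc] using t1.const_mul c
      · exact (g1.const_mul c).congr (fun s => (Tgen_smul _ _ _ _ _ _ _).symm)
  obtain ⟨a', D, _, hd, ht, hg, hcont⟩ := key
  have := tendsto_nhds_unique ha hg
  subst this
  refine ge_of_tendsto ht ?_
  filter_upwards [eventually_gt_atTop (0:ℝ)] with N hN
  refine div_nonneg ?_ hN.le
  have h1 := hd N hN
  have h0 : ∫ ξ, f (N • ξ) ∂(X.p 0 (N⁻¹ • x0)) = 0 := by
    rw [X.init _ (hxN N hN), integral_dirac, smul_inv_smul₀ hN.ne', hf0]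
  have h2 := (hasDerivWithinAt_iff_tendsto_slope.1 h1)
  rw [show Set.Ici (0:ℝ) \ {0} = Set.Ioi 0 by
    ext t; simp only [Set.mem_sdiff, Set.mem_Ici, Set.mem_singleton_iff, Set.mem_Ioi]
    exact ⟨fun h => lt_of_le_of_ne h.1 (Ne.symm h.2), fun h => ⟨h.le, h.ne'⟩⟩] at h2
  refine ge_of_tendsto h2 ?_
  filter_upwards [self_mem_nhdsWithin] with t ht
  rw [slope_def_field, h0, sub_zero, sub_zero]
  have ht0 : 0 ≤ t := le_of_lt ht
  refine div_nonneg (integral_nonneg_of_ae ?_) ht0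
  have hsupp : ∀ᵐ ξ ∂(X.p t (N⁻¹ • x0)), ξ ∈ K := X.supported t ht0 _ (hxN N hN)
  filter_upwards [hsupp] with ξ hξ
  exact hpos _ (hK N hN.le _ hξ)

end pmp
end DC

namespace DC

section barrier
variable {E : Type*} [NormedAddCommGroup E] [InnerProductSpace ℝ E]

lemma Espan_mul {K : Set E} {f g : E → ℝ} (hf : f ∈ Espan K) (hg : g ∈ Espan K) :
    f * g ∈ Espan K := by
  have h := Submodule.mul_mem_mul hf hg
  unfold Espan at h ⊢
  rw [Submodule.span_mul_span] at h
  refine Submodule.span_mono ?_ h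
  rintro _ ⟨_, ⟨u, hu, rfl⟩, _, ⟨v, hv, rfl⟩, rfl⟩
  refine ⟨u + v, ?_, ?_⟩
  · intro x hx
    rw [inner_add_right]
    exact add_nonneg (hu x hx) (hv x hx)
  · funext x
    simp only [eu, Pi.mul_apply]
    rw [← Real.exp_add, inner_add_left]
    congr 1; ring

lemma Espan_pow {K : Set E} {f : E → ℝ} (hf : f ∈ Espan K) (k : ℕ) : f ^ (k + 1) ∈ Espan K := by
  induction k with
  | zero => simpa using hf
  | succ k ih => rw [pow_succ]; exact Espan_mul ih hf

lemma Espan_Tgen [FiniteDimensional ℝ E] [MeasurableSpace E] [BorelSpace E] {K : Set E} {f : E → ℝ} (hf : f ∈ Espan K)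
    {n : ℕ} (x0 b : E) (w : Fin n → E) (lam : Fin n → ℝ) :
    ∃ a, Tendsto (Tgen x0 b w lam f) (𝓝[>] 0) (𝓝 a) := by
  induction hf using Submodule.span_induction with
  | mem f hf =>
    obtain ⟨u, hu, rfl⟩ := hf
    exact ⟨_, Tgen_eu _ _ _ _ _⟩
  | zero =>
    refine ⟨0, ?_⟩
    have : Tgen x0 b w lam (0 : E → ℝ) = fun _ => 0 := by
      funext s; simp [Tgen]
    rw [this]; exact tendsto_const_nhds
  | add f g _ _ hf hg =>
    obtain ⟨a1, g1⟩ := hf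
    obtain ⟨a2, g2⟩ := hg
    exact ⟨a1 + a2, (g1.add g2).congr (fun s => (Tgen_add _ _ _ _ _ _ _).symm)⟩
  | smul c f _ hf =>
    obtain ⟨a1, g1⟩ := hf
    exact ⟨c * a1, (g1.const_mul c).congr (fun s => (Tgen_smul _ _ _ _ _ _ _).symm)⟩

/-- regularized linear functional -/
noncomputable def hh (x0 : E) (ε : ℝ) (v : E) : E → ℝ :=
  fun x => (1 - Real.exp (-(ε * ⟪v, x - x0⟫))) / ε

lemma cone_dual {K : Set E} {c : E} (hc : ∀ x ∈ K, ‖x‖ ≤ ⟪c, x⟫) {v : E} (hv : ‖v‖ ≤ 1) :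
    c + v ∈ dualCone K := by
  intro x hx
  rw [inner_add_right, real_inner_comm]
  have h1 := hc x hx
  have h2 := abs_le.1 (abs_real_inner_le_norm x v)
  nlinarith [norm_nonneg x]

lemma hh_mem {K : Set E} {c : E} (hc : ∀ x ∈ K, ‖x‖ ≤ ⟪c, x⟫) (x0 : E) {ε : ℝ} (h0 : 0 < ε)
    {v : E} (hv : ε * ‖v‖ ≤ 1) : eu c * hh x0 ε v ∈ Espan K := by
  have e1 : eu c * hh x0 ε v
      = (1/ε) • eu (c + 0) - (Real.exp (ε * ⟪v, x0⟫) / ε) • eu (c + ε • v) := by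
    funext x
    simp only [eu, hh, Pi.mul_apply, Pi.sub_apply, Pi.smul_apply, smul_eq_mul, inner_add_left,
      inner_smul_left, inner_sub_right, inner_zero_left, add_zero, RCLike.conj_to_real]
    rw [show -(ε * (⟪v, x⟫ - ⟪v, x0⟫)) = ε * ⟪v, x0⟫ + -(ε * ⟪v, x⟫) by ring,
      show -(⟪c, x⟫ + ε * ⟪v, x⟫) = -⟪c, x⟫ + -(ε * ⟪v, x⟫) by ring, Real.exp_add, Real.exp_add]
    ring
  rw [e1]
  refine Submodule.sub_mem _ (Submodule.smul_mem _ _ ?_) (Submodule.smul_mem _ _ ?_)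
  · exact Submodule.subset_span ⟨_, cone_dual hc (by simp), rfl⟩
  · exact Submodule.subset_span ⟨_, cone_dual hc (by
      rw [norm_smul, Real.norm_eq_abs, abs_of_pos h0]; exact hv), rfl⟩

lemma exp_b1 (y : ℝ) : |1 - Real.exp (-y)| ≤ |y| * Real.exp |y| := by
  have h1 := Real.add_one_le_exp (-y)
  have h2 := Real.add_one_le_exp y
  have h3 : Real.exp (-y) * Real.exp y = 1 := by rw [← Real.exp_add]; simp
  have h4 := Real.exp_pos (-y)
  rcases le_total 0 y with h | h
  · rw [abs_of_nonneg h, abs_le]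
    have := Real.one_le_exp h
    constructor <;> nlinarith
  · rw [abs_of_nonpos h, abs_le]
    have := Real.one_le_exp (x := -y) (by linarith)
    constructor <;> nlinarith

lemma exp_b2 (y : ℝ) : |1 - Real.exp (-y) - y| ≤ y ^ 2 * Real.exp |y| := by
  have h1 := Real.add_one_le_exp (-y)
  have h2 := Real.add_one_le_exp y
  have h3 : Real.exp (-y) * Real.exp y = 1 := by rw [← Real.exp_add]; simp
  have h4 := Real.exp_pos (-y)
  have h5 := Real.exp_pos (y)
  rcases le_total 0 y with h | h
  · rw [abs_of_nonneg h, abs_le]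
    have := Real.one_le_exp h
    have h6 : Real.exp (-y) ≤ 1 := by rw [Real.exp_le_one_iff]; linarith
    constructor <;> nlinarith
  · rw [abs_of_nonpos h, abs_le]
    have := Real.one_le_exp (x := -y) (by linarith)
    constructor <;> nlinarith

lemma exp_b3 (y : ℝ) : |y| * Real.exp (-|y|) ≤ |1 - Real.exp (-y)| := by
  have h1 := Real.add_one_le_exp (-y)
  have h2 := Real.add_one_le_exp y
  have h3 : Real.exp (-y) * Real.exp y = 1 := by rw [← Real.exp_add]; simp
  have h4 := Real.exp_pos (-y)
  have h5 := Real.exp_pos (y)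
  rcases le_total 0 y with h | h
  · rw [abs_of_nonneg h]
    refine le_trans ?_ (le_abs_self _)
    nlinarith
  · rw [abs_of_nonpos h, neg_neg]
    refine le_trans ?_ (neg_le_abs _)
    have : Real.exp y ≤ 1 := by rwa [Real.exp_le_one_iff]
    nlinarith

lemma hh_b1 (x0 : E) {ε M : ℝ} (h0 : 0 < ε) (hεM : ε * M ≤ 1) {v : E} (hv : ‖v‖ ≤ M) (x : E) :
    |⟪v, x - x0⟫| ≤ M * ‖x - x0‖ ∧
    |hh x0 ε v x| ≤ M * ‖x - x0‖ * Real.exp ‖x - x0‖ ∧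
    |hh x0 ε v x - ⟪v, x - x0⟫| ≤ ε * M ^ 2 * ‖x - x0‖ ^ 2 * Real.exp ‖x - x0‖ := by
  set z := x - x0
  have hM : 0 ≤ M := (norm_nonneg v).trans hv
  have h1 : |⟪v, z⟫| ≤ M * ‖z‖ :=
    (abs_real_inner_le_norm v z).trans (mul_le_mul_of_nonneg_right hv (norm_nonneg z))
  have h2 : |ε * ⟪v, z⟫| ≤ ‖z‖ := by
    rw [abs_mul, abs_of_pos h0]
    calc ε * |⟪v, z⟫| ≤ ε * (M * ‖z‖) := by gcongr
      _ = (ε * M) * ‖z‖ := by ring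
      _ ≤ 1 * ‖z‖ := by gcongr
      _ = ‖z‖ := one_mul _
  refine ⟨h1, ?_, ?_⟩
  · simp only [hh]
    rw [abs_div, abs_of_pos h0, div_le_iff₀ h0]
    refine (exp_b1 _).trans ?_
    calc |ε * ⟪v, z⟫| * Real.exp |ε * ⟪v, z⟫| ≤ |ε * ⟪v, z⟫| * Real.exp ‖z‖ := by gcongr
      _ = ε * |⟪v, z⟫| * Real.exp ‖z‖ := by rw [abs_mul, abs_of_pos h0]
      _ ≤ ε * (M * ‖z‖) * Real.exp ‖z‖ := by gcongr
      _ = _ := by ring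
  · have : hh x0 ε v x - ⟪v, z⟫ = (1 - Real.exp (-(ε * ⟪v, z⟫)) - ε * ⟪v, z⟫) / ε := by
      simp only [hh]; rw [sub_div _ (ε * ⟪v, z⟫), mul_div_cancel_left₀ _ h0.ne']
    rw [this, abs_div, abs_of_pos h0, div_le_iff₀ h0]
    refine (exp_b2 _).trans ?_
    calc (ε * ⟪v, z⟫) ^ 2 * Real.exp |ε * ⟪v, z⟫| ≤ (ε * ⟪v, z⟫) ^ 2 * Real.exp ‖z‖ := by gcongr
      _ = ε ^ 2 * |⟪v, z⟫| ^ 2 * Real.exp ‖z‖ := by rw [sq_abs]; ring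
      _ ≤ ε ^ 2 * (M * ‖z‖) ^ 2 * Real.exp ‖z‖ := by gcongr
      _ = _ := by ring

/-- bracket -/
noncomputable def brk {n : ℕ} (x0 p : E) (v : Fin n → E) (m : Fin n → Fin n → E) (ε : ℝ) : E → ℝ :=
  fun x => hh x0 ε p x - (1/2) * ∑ i, hh x0 ε (v i) x ^ 2
    + ∑ i, ∑ k, hh x0 ε (v i) x * hh x0 ε (v k) x * hh x0 ε (m i k) x

/-- the cubic lower bound -/
noncomputable def cub {n : ℕ} (x0 p : E) (v : Fin n → E) (m : Fin n → Fin n → E) : E → ℝ :=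
  fun x => ⟪p, x - x0⟫ - (1/2) * ∑ i, ⟪v i, x - x0⟫ ^ 2
    + ∑ i, ∑ k, ⟪v i, x - x0⟫ * ⟪v k, x - x0⟫ * ⟪m i k, x - x0⟫

lemma brk_bound {n : ℕ} (x0 p : E) (v : Fin n → E) (m : Fin n → Fin n → E) {ε M : ℝ} (h0 : 0 < ε)
    (hεM : ε * M ≤ 1) (hp : ‖p‖ ≤ M) (hv : ∀ i, ‖v i‖ ≤ M) (hm : ∀ i k, ‖m i k‖ ≤ M) (x : E) :
    cub x0 p v m x - ε * (M ^ 2 + n * M ^ 3 + n * n * (3 * M ^ 4)) * ‖x - x0‖ ^ 2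
      * Real.exp ‖x - x0‖ ^ 5 ≤ brk x0 p v m ε x := by
  have hM : 0 ≤ M := (norm_nonneg p).trans hp
  obtain ⟨-, -, hp3⟩ := hh_b1 x0 h0 hεM hp x
  have bv := fun i => hh_b1 x0 h0 hεM (hv i) x
  have bm := fun i k => hh_b1 x0 h0 hεM (hm i k) x
  simp only [brk, cub]
  set τ := ‖x - x0‖ with hτ
  have hτ0 : 0 ≤ τ := norm_nonneg _
  have hT1 : 1 ≤ Real.exp τ := Real.one_le_exp hτ0
  have hτT : τ ≤ Real.exp τ := by linarith [Real.add_one_le_exp τ]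
  set T := Real.exp τ with hT
  have key1 : |hh x0 ε p x - ⟪p, x - x0⟫| ≤ ε * M ^ 2 * τ ^ 2 * T ^ 5 := by
    refine hp3.trans ?_
    gcongr
    exact le_self_pow₀ hT1 (by norm_num)
  have up : ∀ i, |⟪v i, x - x0⟫| ≤ M * τ * T := fun i =>
    (bv i).1.trans (le_mul_of_one_le_right (by positivity) hT1)
  have key2 : ∀ i, |hh x0 ε (v i) x ^ 2 - ⟪v i, x - x0⟫ ^ 2| ≤ 2 * (ε * M ^ 3 * τ ^ 2 * T ^ 5) := by
    intro i
    rw [sq_sub_sq, abs_mul]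
    calc |hh x0 ε (v i) x + ⟪v i, x - x0⟫| * |hh x0 ε (v i) x - ⟪v i, x - x0⟫|
        ≤ (M * τ * T + M * τ * T) * (ε * M ^ 2 * τ ^ 2 * T) := by
          gcongr
          · exact (abs_add_le _ _).trans (add_le_add (bv i).2.1 (up i))
          · exact (bv i).2.2
      _ = 2 * (ε * M ^ 3 * τ ^ 2 * T ^ 2) * τ := by ring
      _ ≤ 2 * (ε * M ^ 3 * τ ^ 2 * T ^ 2) * T := by gcongr
      _ = 2 * (ε * M ^ 3 * τ ^ 2 * T ^ 3) := by ring
      _ ≤ 2 * (ε * M ^ 3 * τ ^ 2 * T ^ 5) := by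
          gcongr
          norm_num
  have key3 : ∀ i k, |hh x0 ε (v i) x * hh x0 ε (v k) x * hh x0 ε (m i k) x
      - ⟪v i, x - x0⟫ * ⟪v k, x - x0⟫ * ⟪m i k, x - x0⟫| ≤ 3 * (ε * M ^ 4 * τ ^ 2 * T ^ 5) := by
    intro i k
    have e1 : hh x0 ε (v i) x * hh x0 ε (v k) x * hh x0 ε (m i k) x
      - ⟪v i, x - x0⟫ * ⟪v k, x - x0⟫ * ⟪m i k, x - x0⟫
      = hh x0 ε (v i) x * hh x0 ε (v k) x * (hh x0 ε (m i k) x - ⟪m i k, x - x0⟫)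
        + hh x0 ε (v i) x * (hh x0 ε (v k) x - ⟪v k, x - x0⟫) * ⟪m i k, x - x0⟫
        + (hh x0 ε (v i) x - ⟪v i, x - x0⟫) * ⟪v k, x - x0⟫ * ⟪m i k, x - x0⟫ := by ring
    have t3 : |⟪m i k, x - x0⟫| ≤ M * τ * T :=
      (bm i k).1.trans (le_mul_of_one_le_right (by positivity) hT1)
    rw [e1]
    have tt : ∀ a b c : ℝ, |a| ≤ M * τ * T → |b| ≤ M * τ * T → |c| ≤ ε * M ^ 2 * τ ^ 2 * T →
        |a| * |b| * |c| ≤ ε * M ^ 4 * τ ^ 2 * T ^ 5 := by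
      intro a b c ha hb hc
      calc |a| * |b| * |c| ≤ (M * τ * T) * (M * τ * T) * (ε * M ^ 2 * τ ^ 2 * T) := by gcongr
        _ = ε * M ^ 4 * τ ^ 2 * T ^ 3 * τ ^ 2 := by ring
        _ ≤ ε * M ^ 4 * τ ^ 2 * T ^ 3 * T ^ 2 := by gcongr
        _ = _ := by ring
    refine (abs_add_le _ _).trans ?_
    have a1 := tt _ _ _ (bv i).2.1 (bv k).2.1 (bm i k).2.2
    have a2 := tt _ _ _ (bv i).2.1 t3 (bv k).2.2
    have a3 := tt _ _ _ (up k) t3 (bv i).2.2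
    have a4 := abs_add_le (hh x0 ε (v i) x * hh x0 ε (v k) x * (hh x0 ε (m i k) x - ⟪m i k, x - x0⟫))
      (hh x0 ε (v i) x * (hh x0 ε (v k) x - ⟪v k, x - x0⟫) * ⟪m i k, x - x0⟫)
    simp only [abs_mul] at a4 ⊢
    linarith
  have s2 : |∑ i, (hh x0 ε (v i) x ^ 2 - ⟪v i, x - x0⟫ ^ 2)|
      ≤ n * (2 * (ε * M ^ 3 * τ ^ 2 * T ^ 5)) := by
    refine (Finset.abs_sum_le_sum_abs _ _).trans ((Finset.sum_le_sum (fun i _ => key2 i)).trans ?_)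
    simp
  have s3 : |∑ i, ∑ k, (hh x0 ε (v i) x * hh x0 ε (v k) x * hh x0 ε (m i k) x
      - ⟪v i, x - x0⟫ * ⟪v k, x - x0⟫ * ⟪m i k, x - x0⟫)|
      ≤ n * (n * (3 * (ε * M ^ 4 * τ ^ 2 * T ^ 5))) := by
    refine (Finset.abs_sum_le_sum_abs _ _).trans ((Finset.sum_le_sum (fun i _ =>
      (Finset.abs_sum_le_sum_abs _ _).trans (Finset.sum_le_sum (fun k _ => key3 i k)))).trans ?_)
    simp
  simp only [Finset.sum_sub_distrib] at s2 s3
  have := (abs_le.1 key1).1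
  have := (abs_le.1 s2).2
  have := (abs_le.1 s3).1
  nlinarith

end barrier
end DC

namespace DC

section barrier2
variable {E : Type*} [NormedAddCommGroup E] [InnerProductSpace ℝ E]

lemma hh_lim (x0 : E) {ε : ℝ} (h0 : 0 < ε) (v y : E) :
    Tendsto (fun s : ℝ => hh x0 ε v (x0 + s • y) / s) (𝓝[>] 0) (𝓝 ⟪v, y⟫) := by
  have h := (exp_slope (-(ε * ⟪v, y⟫))).const_mul (-(1/ε))
  rw [show -(1/ε) * -(ε * ⟪v, y⟫) = ⟪v, y⟫ by field_simp] at h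
  refine h.congr (fun s => ?_)
  simp only [hh, add_sub_cancel_left, inner_smul_right]
  rw [show s * -(ε * ⟪v, y⟫) = -(ε * (s * ⟪v, y⟫)) by ring]
  ring

lemma eu_lim (c x0 y : E) :
    Tendsto (fun s : ℝ => eu c (x0 + s • y)) (𝓝[>] 0) (𝓝 (eu c x0)) := by
  have : Continuous (fun s : ℝ => eu c (x0 + s • y)) := by unfold eu; fun_prop
  have h := (this.tendsto 0).mono_left (nhdsWithin_le_nhds (s := Set.Ioi 0))
  simpa using h

lemma s_lim : Tendsto (fun s : ℝ => s) (𝓝[>] 0) (𝓝 0) := nhdsWithin_le_nhds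

lemma hh_zero (x0 : E) (ε : ℝ) (v : E) : hh x0 ε v x0 = 0 := by simp [hh]

/-- barrier function -/
noncomputable def bar {n : ℕ} (c x0 p : E) (v : Fin n → E) (m : Fin n → Fin n → E) (ε : ℝ) :
    E → ℝ := fun x => eu c x ^ 9 * brk x0 p v m ε x

lemma bar_zero {n : ℕ} (c x0 p : E) (v : Fin n → E) (m : Fin n → Fin n → E) (ε : ℝ) :
    bar c x0 p v m ε x0 = 0 := by
  simp [bar, brk, hh_zero]

lemma bar_mem {K : Set E} {n : ℕ} {c : E} (hc : ∀ x ∈ K, ‖x‖ ≤ ⟪c, x⟫)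
    (x0 p : E) (v : Fin n → E) (m : Fin n → Fin n → E) {ε M : ℝ} (h0 : 0 < ε)
    (hεM : ε * M ≤ 1) (hp : ‖p‖ ≤ M) (hv : ∀ i, ‖v i‖ ≤ M) (hm : ∀ i k, ‖m i k‖ ≤ M) :
    bar c x0 p v m ε ∈ Espan K := by
  have H : ∀ q : E, ‖q‖ ≤ M → eu c * hh x0 ε q ∈ Espan K := fun q hq =>
    hh_mem hc x0 h0 ((mul_le_mul_of_nonneg_left hq h0.le).trans hεM)
  have hg : eu c ∈ Espan K := by
    refine Submodule.subset_span ⟨c, ?_, rfl⟩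
    simpa using cone_dual hc (v := 0) (by simp)
  have e : bar c x0 p v m ε = (eu c) ^ (7 + 1) * (eu c * hh x0 ε p)
      - (1/2 : ℝ) • ∑ i, (eu c) ^ (6 + 1) * (eu c * hh x0 ε (v i)) ^ (1 + 1)
      + ∑ i, ∑ k, (eu c) ^ (5 + 1) * ((eu c * hh x0 ε (v i)) * (eu c * hh x0 ε (v k))
        * (eu c * hh x0 ε (m i k))) := by
    funext x
    simp only [bar, brk, Pi.add_apply, Pi.sub_apply, Pi.mul_apply, Pi.pow_apply, Pi.smul_apply,
      Finset.sum_apply, smul_eq_mul]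
    rw [mul_add, mul_sub, mul_left_comm]
    simp only [Finset.mul_sum]
    congr 1
    · congr 1
      · ring
      · exact Finset.sum_congr rfl (fun i _ => by ring)
    · exact Finset.sum_congr rfl (fun i _ => Finset.sum_congr rfl (fun k _ => by ring))
  rw [e]
  refine Submodule.add_mem _ (Submodule.sub_mem _ ?_ (Submodule.smul_mem _ _ ?_)) ?_
  · exact Espan_mul (Espan_pow hg _) (H p hp)
  · exact Submodule.sum_mem _ (fun i _ => Espan_mul (Espan_pow hg _) (Espan_pow (H _ (hv i)) _))
  · exact Submodule.sum_mem _ (fun i _ => Submodule.sum_mem _ (fun k _ =>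
      Espan_mul (Espan_pow hg _) (Espan_mul (Espan_mul (H _ (hv i)) (H _ (hv k))) (H _ (hm i k)))))

lemma bar_lim1 {n : ℕ} (c x0 p : E) (v : Fin n → E) (m : Fin n → Fin n → E) {ε : ℝ} (h0 : 0 < ε)
    (y : E) : Tendsto (fun s : ℝ => bar c x0 p v m ε (x0 + s • y) / s) (𝓝[>] 0)
      (𝓝 (eu c x0 ^ 9 * ⟪p, y⟫)) := by
  have l := fun q => hh_lim x0 h0 q y
  have h := (((eu_lim c x0 y).pow 9).mul (((l p).sub ((s_lim.mul
    (tendsto_finsetSum Finset.univ (fun i _ => (l (v i)).pow 2))).const_mul (1/2:ℝ))).add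
    ((s_lim.pow 2).mul (tendsto_finsetSum Finset.univ (fun i _ =>
      tendsto_finsetSum Finset.univ (fun k _ => ((l (v i)).mul (l (v k))).mul (l (m i k))))))))
  simp only [zero_mul, mul_zero, sub_zero, zero_pow two_ne_zero, add_zero] at h
  refine h.congr' ?_
  filter_upwards [self_mem_nhdsWithin] with s hs
  have hs0 : s ≠ 0 := ne_of_gt hs
  simp only [bar, brk]
  rw [mul_div_assoc, add_div, sub_div]
  congr 1
  simp only [Finset.mul_sum, Finset.sum_div]
  congr 1
  · congr 1
    exact Finset.sum_congr rfl (fun i _ => by field_simp)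
  · exact Finset.sum_congr rfl (fun i _ => Finset.sum_congr rfl (fun k _ => by field_simp))

lemma bar_lim2 {n : ℕ} (c x0 p : E) (v : Fin n → E) (m : Fin n → Fin n → E) {ε : ℝ} (h0 : 0 < ε)
    (y : E) (hy : ⟪p, y⟫ = 0) :
    Tendsto (fun s : ℝ => bar c x0 p v m ε (x0 + s • y) / s ^ 2) (𝓝[>] 0)
      (𝓝 (eu c x0 ^ 9 * (-(1/2) * ∑ i, ⟪v i, y⟫ ^ 2))) := by
  have l := fun q => hh_lim x0 h0 q y
  have h := (((eu_lim c x0 y).pow 9).mul (((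
    (tendsto_finsetSum Finset.univ (fun i _ => (l (v i)).pow 2))).const_mul (-(1/2):ℝ)).add
    (s_lim.mul (tendsto_finsetSum Finset.univ (fun i _ =>
      tendsto_finsetSum Finset.univ (fun k _ => ((l (v i)).mul (l (v k))).mul (l (m i k))))))))
  simp only [zero_mul, add_zero] at h
  refine h.congr' ?_
  filter_upwards [self_mem_nhdsWithin] with s hs
  have hs0 : s ≠ 0 := ne_of_gt hs
  have hp0 : hh x0 ε p (x0 + s • y) = 0 := by simp [hh, inner_smul_right, hy]
  simp only [bar, brk, hp0]
  rw [mul_div_assoc, add_div, zero_sub, neg_div]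
  congr 1
  simp only [Finset.mul_sum, Finset.sum_div, ← Finset.sum_neg_distrib]
  congr 1
  · exact Finset.sum_congr rfl (fun i _ => by field_simp)
  · exact Finset.sum_congr rfl (fun i _ => Finset.sum_congr rfl (fun k _ => by field_simp))

lemma bar_Tgen {n N : ℕ} (c x0 p : E) (v : Fin n → E) (m : Fin n → Fin n → E) {ε : ℝ} (h0 : 0 < ε)
    (b : E) (w : Fin N → E) (lam : Fin N → ℝ) (hw : ∀ j, lam j = 0 ∨ ⟪p, w j⟫ = 0) :
    Tendsto (Tgen x0 b w lam (bar c x0 p v m ε)) (𝓝[>] 0)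
      (𝓝 (eu c x0 ^ 9 * (⟪p, b⟫ - (1/2) * ∑ j, lam j * ∑ i, ⟪v i, w j⟫ ^ 2))) := by
  have h2 : ∀ j, Tendsto (fun s : ℝ => lam j * ((bar c x0 p v m ε (x0 + s • w j)
      + bar c x0 p v m ε (x0 - s • w j) - 2 * bar c x0 p v m ε x0) / s ^ 2)) (𝓝[>] 0)
      (𝓝 (lam j * (-(eu c x0 ^ 9 * ∑ i, ⟪v i, w j⟫ ^ 2)))) := by
    intro j
    rcases hw j with h | h
    · simp [h]
    · apply Tendsto.const_mul
      have t1 := bar_lim2 c x0 p v m h0 (w j) h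
      have t2 := bar_lim2 c x0 p v m h0 (-(w j)) (by rw [inner_neg_right, h, neg_zero])
      have t3 := t1.add t2
      simp only [inner_neg_right, neg_sq, smul_neg, ← sub_eq_add_neg] at t3
      rw [show eu c x0 ^ 9 * (-(1/2) * ∑ i, ⟪v i, w j⟫ ^ 2)
        + eu c x0 ^ 9 * (-(1/2) * ∑ i, ⟪v i, w j⟫ ^ 2)
        = -(eu c x0 ^ 9 * ∑ i, ⟪v i, w j⟫ ^ 2) by ring] at t3
      refine t3.congr (fun s => ?_)
      rw [bar_zero]
      ring
  have h3 := (bar_lim1 c x0 p v m h0 b).add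
    ((tendsto_finsetSum Finset.univ (fun j _ => h2 j)).const_mul (1/2:ℝ))
  have e : eu c x0 ^ 9 * ⟪p, b⟫ + 1/2 * ∑ j, lam j * (-(eu c x0 ^ 9 * ∑ i, ⟪v i, w j⟫ ^ 2))
      = eu c x0 ^ 9 * (⟪p, b⟫ - (1/2) * ∑ j, lam j * ∑ i, ⟪v i, w j⟫ ^ 2) := by
    have e2 : ∑ j, lam j * (-(eu c x0 ^ 9 * ∑ i, ⟪v i, w j⟫ ^ 2))
        = -(eu c x0 ^ 9 * ∑ j, lam j * ∑ i, ⟪v i, w j⟫ ^ 2) := by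
      rw [Finset.mul_sum, ← Finset.sum_neg_distrib]
      exact Finset.sum_congr rfl (fun j _ => by ring)
    rw [e2]; ring
  rw [e] at h3
  refine h3.congr (fun s => ?_)
  simp only [Tgen, bar_zero, sub_zero]

/-- quadratic penalty -/
noncomputable def pen {N : ℕ} (c x0 : E) (u : Fin N → E) : E → ℝ :=
  ∑ k, (eu c * hh x0 1 (u k)) ^ (1 + 1)

lemma pen_mem {K : Set E} {N : ℕ} {c : E} (hc : ∀ x ∈ K, ‖x‖ ≤ ⟪c, x⟫)
    (x0 : E) (u : Fin N → E) (hu : ∀ k, ‖u k‖ ≤ 1) : pen c x0 u ∈ Espan K :=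
  Submodule.sum_mem _ (fun k _ => Espan_pow (hh_mem hc x0 one_pos (by simpa using hu k)) _)

lemma pen_zero {N : ℕ} (c x0 : E) (u : Fin N → E) : pen c x0 u x0 = 0 := by
  simp [pen, hh_zero]

lemma pen_bound {N : ℕ} (c x0 : E) (u : OrthonormalBasis (Fin N) ℝ E) (x : E) :
    eu c x ^ 2 * (‖x - x0‖ ^ 2 * Real.exp (-‖x - x0‖) ^ 2) ≤ pen c x0 u x := by
  simp only [pen, Finset.sum_apply, Pi.pow_apply, Pi.mul_apply]
  have h : ‖x - x0‖ ^ 2 = ∑ k, ⟪u k, x - x0⟫ ^ 2 := by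
    rw [← u.sum_sq_norm_inner_right (x - x0)]
    simp
  conv_lhs => rw [h]
  rw [Finset.sum_mul, Finset.mul_sum]
  refine Finset.sum_le_sum (fun k _ => ?_)
  rw [show (1 + 1) = 2 from rfl, mul_pow]
  gcongr
  simp only [hh, one_mul, div_one]
  rw [← sq_abs (1 - _), ← sq_abs ⟪u k, x - x0⟫, ← mul_pow]
  gcongr
  refine le_trans ?_ (exp_b3 _)
  gcongr
  have := abs_real_inner_le_norm (u k) (x - x0)
  simpa using this

lemma total_nonneg {K : Set E} {n N : ℕ} {c : E} (hc : ∀ x ∈ K, ‖x‖ ≤ ⟪c, x⟫)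
    (x0 p : E) (v : Fin n → E) (m : Fin n → Fin n → E) {ε M : ℝ} (h0 : 0 < ε)
    (hεM : ε * M ≤ 1) (hp : ‖p‖ ≤ M) (hv : ∀ i, ‖v i‖ ≤ M) (hm : ∀ i k, ‖m i k‖ ≤ M)
    (u : OrthonormalBasis (Fin N) ℝ E) (hcub : ∀ x ∈ K, 0 ≤ cub x0 p v m x) {x : E} (hx : x ∈ K) :
    0 ≤ bar c x0 p v m ε x + ε * ((M ^ 2 + n * M ^ 3 + n * n * (3 * M ^ 4))
      * Real.exp ‖x0‖ ^ 7) * pen c x0 u x := by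
  have hM : 0 ≤ M := (norm_nonneg p).trans hp
  have h1 := brk_bound x0 p v m h0 hεM hp hv hm x
  have h2 := pen_bound c x0 u x
  have h3 := hcub x hx
  set C := (M ^ 2 + n * M ^ 3 + n * n * (3 * M ^ 4)) with hC
  have hC0 : 0 ≤ C := by positivity
  set τ := ‖x - x0‖ with hτ
  set T := Real.exp τ with hT
  have hT0 : 0 < T := Real.exp_pos _
  set g := eu c x with hg
  have hg0 : 0 < g := Real.exp_pos _
  have hTT : Real.exp (-τ) * T = 1 := by rw [hT, ← Real.exp_add]; simp
  have hTg : T * g ≤ Real.exp ‖x0‖ := by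
    rw [hT, hg, eu, ← Real.exp_add, Real.exp_le_exp]
    have := norm_sub_le x x0
    have := hc x hx
    linarith
  have h4 : -(ε * C * τ ^ 2 * T ^ 5) ≤ brk x0 p v m ε x := by linarith
  have h5 : g ^ 9 * -(ε * C * τ ^ 2 * T ^ 5) ≤ bar c x0 p v m ε x :=
    mul_le_mul_of_nonneg_left h4 (by positivity)
  have h6 : g ^ 9 * (ε * C * τ ^ 2 * T ^ 5)
      ≤ ε * (C * Real.exp ‖x0‖ ^ 7) * pen c x0 u x := by
    calc g ^ 9 * (ε * C * τ ^ 2 * T ^ 5)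
        = ε * (C * (T * g) ^ 7) * (g ^ 2 * (τ ^ 2 * Real.exp (-τ) ^ 2)) := by
          have : (Real.exp (-τ) * T) ^ 2 = 1 := by rw [hTT, one_pow]
          calc _ = g ^ 9 * (ε * C * τ ^ 2 * T ^ 5) * 1 := by ring
            _ = g ^ 9 * (ε * C * τ ^ 2 * T ^ 5) * (Real.exp (-τ) * T) ^ 2 := by rw [this]
            _ = _ := by ring
      _ ≤ ε * (C * Real.exp ‖x0‖ ^ 7) * pen c x0 u x := by gcongr
  linarith

end barrier2

section core
variable {E : Type*} [NormedAddCommGroup E] [InnerProductSpace ℝ E] [FiniteDimensional ℝ E]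
  [MeasurableSpace E] [BorelSpace E]

lemma core {K : Set E} {φ : ℝ → E → ℝ} {ψ : ℝ → E → E} (X : AffineTransitionFamily K φ ψ)
    (hK : ∀ c : ℝ, 0 ≤ c → ∀ x ∈ K, c • x ∈ K)
    {χ : E → E} (hχ : IsTruncation χ)
    {F : E → ℝ} {R : E → E}
    (hF : ∀ u ∈ dualCone K, HasDerivWithinAt (fun t => φ t u) (F u) (Set.Ici (0 : ℝ)) 0)
    (hR : ∀ u ∈ dualCone K, HasDerivWithinAt (fun t => ψ t u) (R u) (Set.Ici (0 : ℝ)) 0)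
    (PF : FParams K F) (PR : RParams K χ R) {x0 : E} (hx0 : x0 ∈ K)
    {n N : ℕ} (w : Fin N → E) (lam : Fin N → ℝ)
    (hq : ∀ u, ⟪PR.Q u u, x0⟫ = ∑ j, lam j * ⟪u, w j⟫ ^ 2)
    {c : E} (hc : ∀ x ∈ K, ‖x‖ ≤ ⟪c, x⟫) (p : E) (v : Fin n → E) (m : Fin n → Fin n → E)
    (hcub : ∀ x ∈ K, 0 ≤ cub x0 p v m x) (hw : ∀ j, lam j = 0 ∨ ⟪p, w j⟫ = 0) :
    0 ≤ ⟪p, PF.b⟫ - (1/2) * ∑ j, lam j * ∑ i, ⟪v i, w j⟫ ^ 2 := by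
  obtain ⟨M, hM1, hp, hv, hm⟩ : ∃ M : ℝ, 1 ≤ M ∧ ‖p‖ ≤ M ∧ (∀ i, ‖v i‖ ≤ M)
      ∧ ∀ i k, ‖m i k‖ ≤ M := by
    have n1 : ∀ i, ‖v i‖ ≤ ∑ i, ‖v i‖ := fun i =>
      Finset.single_le_sum (f := fun i => ‖v i‖) (fun i _ => norm_nonneg _) (Finset.mem_univ i)
    have n2 : ∀ i k, ‖m i k‖ ≤ ∑ i, ∑ k, ‖m i k‖ := fun i k =>
      (Finset.single_le_sum (f := fun k => ‖m i k‖) (fun i _ => norm_nonneg _)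
        (Finset.mem_univ k)).trans
      (Finset.single_le_sum (f := fun i => ∑ k, ‖m i k‖)
        (fun i _ => Finset.sum_nonneg (fun i _ => norm_nonneg _)) (Finset.mem_univ i))
    have n3 : 0 ≤ ∑ i, ‖v i‖ := Finset.sum_nonneg (fun i _ => norm_nonneg _)
    have n4 : 0 ≤ ∑ i, ∑ k, ‖m i k‖ :=
      Finset.sum_nonneg (fun i _ => Finset.sum_nonneg (fun i _ => norm_nonneg _))
    have n5 := norm_nonneg p
    exact ⟨1 + ‖p‖ + ∑ i, ‖v i‖ + ∑ i, ∑ k, ‖m i k‖, by linarith, by linarith,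
      fun i => by linarith [n1 i], fun i k => by linarith [n2 i k]⟩
  let u := stdOrthonormalBasis ℝ E
  have hpm := pen_mem hc x0 u (fun k => by simp)
  obtain ⟨aG, haG⟩ := Espan_Tgen hpm x0 PF.b w lam
  set C' := (M ^ 2 + n * M ^ 3 + n * n * (3 * M ^ 4)) * Real.exp ‖x0‖ ^ 7 with hC'
  set A := ⟪p, PF.b⟫ - (1/2) * ∑ j, lam j * ∑ i, ⟪v i, w j⟫ ^ 2 with hA
  have main : ∀ ε : ℝ, 0 < ε → ε * M ≤ 1 → 0 ≤ eu c x0 ^ 9 * A + ε * C' * aG := by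
    intro ε h0 hε
    refine pmp X hK hχ hF hR PF PR hx0 w lam hq
      (f := bar c x0 p v m ε + (ε * C') • pen c x0 u) ?_ ?_ ?_ ?_
    · exact Submodule.add_mem _ (bar_mem hc x0 p v m h0 hε hp hv hm) (Submodule.smul_mem _ _ hpm)
    · intro x hx
      exact total_nonneg hc x0 p v m h0 hε hp hv hm u hcub hx
    · simp [bar_zero, pen_zero]
    · have t := (bar_Tgen c x0 p v m h0 PF.b w lam hw).add (haG.const_mul (ε * C'))
      refine t.congr (fun s => ?_)
      rw [Tgen_add, Tgen_smul]
  have hl : Tendsto (fun ε : ℝ => eu c x0 ^ 9 * A + ε * C' * aG) (𝓝[>] 0)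
      (𝓝 (eu c x0 ^ 9 * A)) := by
    have := ((s_lim.mul_const C').mul_const aG).const_add (eu c x0 ^ 9 * A)
    simpa using this
  have h9 : 0 ≤ eu c x0 ^ 9 * A := by
    refine ge_of_tendsto hl ?_
    have hMp : 0 < M := by linarith
    have : Set.Ioo (0:ℝ) (1/M) ∈ 𝓝[>] (0:ℝ) := Ioo_mem_nhdsGT (by positivity)
    filter_upwards [this] with ε hε
    exact main ε hε.1 (by have := hε.2.le; rwa [le_div_iff₀ hMp] at this)
  have hg : 0 < eu c x0 ^ 9 := pow_pos (Real.exp_pos _) 9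
  exact nonneg_of_mul_nonneg_right h9 hg

end core
end DC

namespace DC

section final
variable {E : Type*} [NormedAddCommGroup E] [InnerProductSpace ℝ E] [FiniteDimensional ℝ E]
  (J : EuclideanJordanAlgebra E)

/-- diagonalization of the diffusion form -/
lemma diag (S : E →ₗ[ℝ] E →ₗ[ℝ] ℝ) (hs : ∀ u v, S u v = S v u) (hpos : ∀ u, 0 ≤ S u u) :
    ∃ (N : ℕ) (w : Fin N → E) (lam : Fin N → ℝ), (∀ j, 0 ≤ lam j) ∧
      ∀ u, S u u = ∑ j, lam j * ⟪u, w j⟫ ^ 2 := by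
  let T : E →ₗ[ℝ] E :=
    { toFun := fun u => (InnerProductSpace.toDual ℝ E).symm (LinearMap.toContinuousLinearMap (S u))
      map_add' := fun a b => by simp
      map_smul' := fun a b => by simp }
  have hT : ∀ u v, ⟪T u, v⟫ = S u v := fun u v => by simp [T]
  have hsym : T.IsSymmetric := fun u v => by rw [hT, real_inner_comm, hT, hs]
  let B := hsym.eigenvectorBasis (n := Module.finrank ℝ E) rfl
  let l := hsym.eigenvalues (n := Module.finrank ℝ E) rfl
  have hB : ∀ j, T (B j) = l j • B j := fun j => hsym.apply_eigenvectorBasis rfl j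
  refine ⟨Module.finrank ℝ E, B, l, ?_, ?_⟩
  · intro j
    have := hpos (B j)
    rw [← hT, hB, inner_smul_left] at this
    simpa using this
  · intro u
    rw [← hT, ← B.sum_inner_mul_inner (T u) u]
    refine Finset.sum_congr rfl (fun j _ => ?_)
    rw [hsym u (B j), hB, inner_smul_right, real_inner_comm u (B j)]
    ring

lemma P_inner (u a x : E) : ⟪J.P u a, x⟫ = ⟪a, J.P u x⟫ := by
  simp only [EuclideanJordanAlgebra.P, EuclideanJordanAlgebra.L, LinearMap.sub_apply,
    LinearMap.smul_apply, LinearMap.comp_apply, inner_sub_left, inner_sub_right,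
    inner_smul_left, inner_smul_right, J.compat, RCLike.conj_to_real]

lemma P_p {p : E} (hp : J.mul p p = p) : J.P p (J.e - p) = 0 := by
  simp only [EuclideanJordanAlgebra.P, EuclideanJordanAlgebra.L, LinearMap.sub_apply,
    LinearMap.smul_apply, LinearMap.comp_apply, map_sub, J.comm p J.e, J.unit, hp]
  simp

lemma half_inner {p v : E} (hv : J.mul p v = (1/2:ℝ) • v) (w : E) :
    ⟪p, J.mul v w⟫ = (1/2) * ⟪v, w⟫ := by
  rw [← J.compat, J.comm v p, hv, inner_smul_left]; simp

lemma half_sq_eq {p v : E} (hp : J.IsPrimitive p) (hpp : ⟪p, p⟫ = 1)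
    (hv : J.mul p v = (1/2:ℝ) • v) :
    J.mul p (J.mul v v) = ((1/2) * ⟪v, v⟫) • p := by
  have hpi : J.mul p p = p := hp.1
  obtain ⟨c, hc⟩ := prim_one J hp (half_sq J hpi hv)
  have h1 : ⟪p, J.mul p (J.mul v v)⟫ = c := by rw [hc, inner_smul_right, hpp, mul_one]
  rw [← J.compat, hpi, half_inner J hv] at h1
  rw [hc, h1]

lemma P_half {p v : E} (hp : J.IsPrimitive p) (hpp : ⟪p, p⟫ = 1)
    (hv : J.mul p v = (1/2:ℝ) • v) : J.P v (J.e - p) = ((1/2) * ⟪v, v⟫) • p := by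
  have h := half_sq_eq J hp hpp hv
  simp only [EuclideanJordanAlgebra.P, EuclideanJordanAlgebra.L, LinearMap.sub_apply,
    LinearMap.smul_apply, LinearMap.comp_apply, map_sub, J.comm v J.e, J.unit, J.comm v p, hv,
    J.comm (J.mul v v) J.e, J.comm (J.mul v v) p, map_smul, h]
  module

lemma half_orth_p {p v : E} (hp : J.mul p p = p) (hv : J.mul p v = (1/2:ℝ) • v) : ⟪p, v⟫ = 0 := by
  have h := J.compat p p v
  rw [hp, hv, inner_smul_right] at h
  linarith

lemma half_orth_e {p v : E} (hp : J.mul p p = p) (hv : J.mul p v = (1/2:ℝ) • v) :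
    ⟪J.e, v⟫ = 0 := by
  have h := J.compat p J.e v
  rw [J.comm, J.unit, hv, inner_smul_right, half_orth_p J hp hv] at h
  linarith

lemma exists_c : ∃ c : E, ∀ x ∈ J.cone, ‖x‖ ≤ ⟪c, x⟫ := by
  let B : E →L[ℝ] E →L[ℝ] E :=
    LinearMap.toContinuousLinearMap
      ((LinearMap.toContinuousLinearMap : (E →ₗ[ℝ] E) ≃ₗ[ℝ] (E →L[ℝ] E)).toLinearMap ∘ₗ J.mul)
  refine ⟨‖B‖ • J.e, ?_⟩
  rintro _ ⟨z, rfl⟩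
  have h1 : ‖J.mul z z‖ ≤ ‖B‖ * ‖z‖ * ‖z‖ := B.le_opNorm₂ z z
  rw [inner_smul_left, inner_idem, J.unit, real_inner_self_eq_norm_mul_norm]
  simpa [mul_assoc] using h1

lemma cub_nonneg {p : E} (hp : J.mul p p = p) (hpp : ⟪p, p⟫ = 1) {n : ℕ} (v : Fin n → E)
    (hv : ∀ i, J.mul p (v i) = (1/2:ℝ) • v i) (hon : Orthonormal ℝ v) {x : E} (hx : x ∈ J.cone) :
    0 ≤ cub (J.e - p) p v (fun i k => J.mul (v i) (v k)) x := by
  obtain ⟨y, rfl⟩ := hx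
  set x := J.mul y y with hx
  set z := x - (J.e - p) with hz
  set W : E := -∑ i, ⟪v i, z⟫ • v i with hW
  have hpW : J.mul p W = (1/2:ℝ) • W := by
    simp only [hW, map_neg, map_sum, map_smul, hv, smul_neg, Finset.smul_sum]
    congr 1
    exact Finset.sum_congr rfl (fun i _ => smul_comm _ _ _)
  have h := cone_inner J (p + W) y
  rw [← hx] at h
  have e1 : J.mul (p + W) (p + W) = p + W + J.mul W W := by
    simp only [map_add, LinearMap.add_apply, J.comm W p, hpW, hp]
    module
  have hxz : x = z + (J.e - p) := by rw [hz]; abel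
  have hpW0 := half_orth_p J hp hpW
  have heW0 := half_orth_e J hp hpW
  have hpe : ⟪p, J.e⟫ = 1 := by
    rw [← hpp]
    have := J.compat p p J.e
    rw [hp, J.comm, J.unit] at this
    exact this
  have hWW : ⟪J.mul W W, J.e - p⟫ = (1/2) * ⟪W, W⟫ := by
    rw [inner_sub_right, real_inner_comm p, half_inner J hpW, real_inner_comm, inner_idem, J.unit]
    ring
  have hWn : ⟪W, W⟫ = ∑ i, ⟪v i, z⟫ ^ 2 := by
    rw [hW, inner_neg_neg, hon.inner_sum]
    exact Finset.sum_congr rfl (fun i _ => by simp [sq])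
  have hWz : ⟪W, z⟫ = -∑ i, ⟪v i, z⟫ ^ 2 := by
    rw [hW, inner_neg_left, sum_inner]
    congr 1
    exact Finset.sum_congr rfl (fun i _ => by rw [inner_smul_left]; simp [sq])
  have hWWz : ⟪J.mul W W, z⟫ = ∑ i, ∑ k, ⟪v i, z⟫ * ⟪v k, z⟫ * ⟪J.mul (v i) (v k), z⟫ := by
    have e0 : J.mul W W = J.mul (∑ i, ⟪v i, z⟫ • v i) (∑ i, ⟪v i, z⟫ • v i) := by
      rw [hW, map_neg, map_neg, LinearMap.neg_apply, neg_neg]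
    rw [e0]
    simp only [map_sum, LinearMap.sum_apply, map_smul,
      LinearMap.smul_apply, sum_inner, inner_smul_left, RCLike.conj_to_real, Finset.mul_sum]
    rw [Finset.sum_comm]
    exact Finset.sum_congr rfl (fun i _ => Finset.sum_congr rfl (fun k _ => by ring))
  have e2 : ⟪p + W + J.mul W W, x⟫ = cub (J.e - p) p v (fun i k => J.mul (v i) (v k)) x := by
    have e3 : ⟪W, J.e - p⟫ = 0 := by
      rw [inner_sub_right, real_inner_comm, heW0, real_inner_comm, hpW0, sub_zero]
    have e4 : ⟪p, J.e - p⟫ = 0 := by rw [inner_sub_right, hpe, hpp, sub_self]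
    simp only [cub, ← hz]
    rw [hxz, inner_add_right, inner_add_left, inner_add_left, inner_add_left, inner_add_left, hWz,
      hWWz, hWW, hWn, e3, e4]
    ring
  rw [← e2, ← e1]
  exact h

variable [MeasurableSpace E] [BorelSpace E]

lemma prim_ineq {φ : ℝ → E → ℝ} {ψ : ℝ → E → E} (X : AffineTransitionFamily J.cone φ ψ)
    {χ : E → E} (hχ : IsTruncation χ)
    {F : E → ℝ} {R : E → E}
    (hF : ∀ u ∈ dualCone J.cone, HasDerivWithinAt (fun t => φ t u) (F u) (Set.Ici (0 : ℝ)) 0)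
    (hR : ∀ u ∈ dualCone J.cone, HasDerivWithinAt (fun t => ψ t u) (R u) (Set.Ici (0 : ℝ)) 0)
    (PF : FParams J.cone F) (PR : RParams J.cone χ R) (α : E)
    (hQ : ∀ u : E, PR.Q u u = (4 : ℝ) • J.P u α) {p : E} (hp : J.IsPrimitive p)
    (hpp : ⟪p, p⟫ = 1) :
    0 ≤ ⟪p, PF.b⟫ - (Module.finrank ℝ (half J p) : ℝ) * ⟪p, α⟫ := by
  have hpi : J.mul p p = p := hp.1
  have hx0 : J.e - p ∈ J.cone := ⟨J.e - p, (compl_idem J hpi).symm⟩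
  have hK : ∀ c : ℝ, 0 ≤ c → ∀ x ∈ J.cone, c • x ∈ J.cone := by
    rintro c hc _ ⟨z, rfl⟩
    refine ⟨Real.sqrt c • z, ?_⟩
    rw [map_smul, map_smul, LinearMap.smul_apply, smul_smul, Real.mul_self_sqrt hc]
  let S : E →ₗ[ℝ] E →ₗ[ℝ] ℝ := PR.Q.compr₂ (innerₛₗ ℝ (J.e - p))
  have hS : ∀ u v, S u v = ⟪J.e - p, PR.Q u v⟫ := fun u v => rfl
  obtain ⟨N, w, lam, hl, hw⟩ := diag S (fun u v => by rw [hS, hS, PR.Q_symm])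
    (fun u => by rw [hS]; exact PR.Q_pos u _ hx0)
  have hq : ∀ u, ⟪PR.Q u u, J.e - p⟫ = ∑ j, lam j * ⟪u, w j⟫ ^ 2 := fun u => by
    rw [← hw, hS, real_inner_comm]
  have hqP : ∀ u, ⟪PR.Q u u, J.e - p⟫ = 4 * ⟪α, J.P u (J.e - p)⟫ := fun u => by
    rw [hQ, inner_smul_left, P_inner]; simp
  have hw0 : ∀ j, lam j = 0 ∨ ⟪p, w j⟫ = 0 := by
    have h1 := hq p
    rw [hqP, P_p J hpi, inner_zero_right, mul_zero] at h1
    have h2 := (Finset.sum_eq_zero_iff_of_nonneg (fun j _ => mul_nonneg (hl j) (sq_nonneg _))).1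
      h1.symm
    intro j
    have := h2 j (Finset.mem_univ j)
    simpa using this
  obtain ⟨c, hc⟩ := exists_c J
  let bs := stdOrthonormalBasis ℝ (half J p)
  let v : Fin (Module.finrank ℝ (half J p)) → E := fun i => (bs i : E)
  have hv : ∀ i, J.mul p (v i) = (1/2:ℝ) • v i := fun i => (mem_half J).1 (bs i).2
  have hon : Orthonormal ℝ v := bs.orthonormal.comp_linearIsometry (half J p).subtypeₗᵢ
  have hmain := core X hK hχ hF hR PF PR hx0 w lam hq hc p v (fun i k => J.mul (v i) (v k))
    (fun x hx => cub_nonneg J hpi hpp v hv hon hx) hw0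
  have hsum : ∑ j, lam j * ∑ i, ⟪v i, w j⟫ ^ 2
      = Module.finrank ℝ (half J p) * (2 * ⟪p, α⟫) := by
    simp only [Finset.mul_sum]
    rw [Finset.sum_comm]
    have : ∀ i, ∑ j, lam j * ⟪v i, w j⟫ ^ 2 = 2 * ⟪p, α⟫ := by
      intro i
      rw [← hq, hqP, P_half J hp hpp (hv i), inner_smul_right, real_inner_self_eq_norm_sq,
        hon.1 i, real_inner_comm]
      ring
    simp only [this]
    simp
  rw [hsum] at hmain
  linarith

end final
end DC
/-- drift condition.  For an affine process on the cone of squares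
`K` of a simple Euclidean Jordan algebra of rank `r` and Peirce invariant `d`,
whose `F` has constant drift parameter `b` and whose `R` has diffusion part
`Q(u,u) = 4 P(u) α` with `α ∈ K`, one has `b ⪰ d(r-1)α`, i.e.
`b - d(r-1)α ∈ K`. -/
theorem drift_condition
    {V : Type*} [NormedAddCommGroup V] [InnerProductSpace ℝ V] [FiniteDimensional ℝ V]
    [MeasurableSpace V] [BorelSpace V]
    (J : EuclideanJordanAlgebra V) (hsimple : J.IsSimple) (htr : J.TraceNormalized)
    (r d : ℕ) (hrank : J.HasRank r) (hpeirce : J.HasPeirceInvariant d)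
    (φ : ℝ → V → ℝ) (ψ : ℝ → V → V)
    (X : AffineTransitionFamily J.cone φ ψ)
    (χ : V → V) (hχ : IsTruncation χ)
    (F : V → ℝ) (R : V → V)
    (hF : ∀ u ∈ dualCone J.cone,
      HasDerivWithinAt (fun t => φ t u) (F u) (Set.Ici (0 : ℝ)) 0)
    (hR : ∀ u ∈ dualCone J.cone,
      HasDerivWithinAt (fun t => ψ t u) (R u) (Set.Ici (0 : ℝ)) 0)
    (PF : FParams J.cone F) (PR : RParams J.cone χ R)
    (α : V) (hα : α ∈ J.cone)
    (hQ : ∀ u : V, PR.Q u u = (4 : ℝ) • J.P u α) :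
    PF.b - ((d : ℝ) * ((r : ℝ) - 1)) • α ∈ J.cone := by
  obtain ⟨k, p, l, hp, ha⟩ := DC.exists_frame J (PF.b - ((d : ℝ) * ((r : ℝ) - 1)) • α)
  have hk := hrank.2 k p hp
  subst hk
  have hl : ∀ i, 0 ≤ l i := by
    intro i
    have hpp := htr (p i) (hp.1 i)
    have h1 := DC.prim_ineq J X hχ hF hR PF PR α hQ (hp.1 i) hpp
    rw [DC.finrank_half J hp i hpeirce] at h1
    have h2 : ⟪p i, PF.b - ((d : ℝ) * ((k : ℝ) - 1)) • α⟫ = l i := by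
      rw [ha, inner_sum, Finset.sum_eq_single i]
      · rw [inner_smul_right, hpp, mul_one]
      · intro j _ hj
        rw [inner_smul_right, DC.inner_of_orth J (hp.2.1 i j (Ne.symm hj)), mul_zero]
      · intro h; exact absurd (Finset.mem_univ i) h
    rw [inner_sub_right, inner_smul_right] at h2
    linarith
  refine ⟨∑ i, Real.sqrt (l i) • p i, ?_⟩
  rw [ha]
  simp only [map_sum, LinearMap.sum_apply, map_smul, LinearMap.smul_apply]
  refine Finset.sum_congr rfl (fun i _ => ?_)
  rw [Finset.sum_eq_single i]
  · have hpi : J.mul (p i) (p i) = p i := (hp.1 i).1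
    rw [hpi, smul_smul, Real.mul_self_sqrt (hl i)]
  · intro j _ hj
    simp [hp.2.1 i j (Ne.symm hj), hp.2.1 j i hj]
  · intro h; exact absurd (Finset.mem_univ i) h
end

section
/- Let V be a simple Euclidean Jordan algebra of dimension n and rank r with trace-normalized inner product, K its cone of squares, and α ∈ K. Let x ∈ V be such that the quadratic representation P(x) is an invertible linear operator, and set x⁻¹ := P(x)⁻¹x. Then every symmetric linear operator A on V satisfying ⟨u, A u⟩ = 4⟨x, P(u)α⟩ for all u ∈ V satisfies Tr(A ∘ P(x)⁻¹) = 4 (n/r) ⟨x⁻¹, α⟩, where Tr denotes the trace of a linear operator on V. -/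
open MeasureTheory Filter Set
open scoped RealInnerProductSpace ENNReal Topology

section RingLemmas
variable {R : Type*} [Ring R]

theorem ring_aux1 (c x s w : R) (h : c * s + x * w + x * w = s * c + w * x + w * x) :
    c * (x * x + x * x - s) + (x * x + x * x - s) * c
      = 2 * (x * w + w * x - (w * x + w * x + s * c - c * x * x - x * x * c)) := by
  linear_combination (norm := noncomm_ring) -h

theorem ring_aux2 (d x s w u : R) (h1 : d * x - x * d = w) (h2 : d * s - s * d = u + u) :
    d * (x * x + x * x - s) - (x * x + x * x - s) * d = 2 * (x * w + w * x - u) := by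
  subst h1
  linear_combination (norm := noncomm_ring) -h2

theorem ring_aux3 (x s : R) (h : x * s = s * x) :
    (x * x + x * x - s) * x = x * (x * x + x * x - s) := by
  linear_combination (norm := noncomm_ring) h

theorem ring_aux4 (x y s : R) (e1 : x + x + y * s = x + x + s * y)
    (e2 : x = s * y + x + x - x * y * x - x * y * x) :
    y * (x * x + x * x - s) = x - 2 * ((x * y - y * x) * x) := by
  linear_combination (norm := noncomm_ring) e2 - e1

theorem ring_aux5 (x d q : R) (h1 : d * x - x * d = 0) (h2 : q * x = x * q) :
    x * ((x - 2 * (d * x)) * q) = (x - 2 * (d * x)) * q * x := by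
  have a1 : x * (q * x) = x * (x * q) := by rw [h2]
  have a2 : d * x * (q * x) = d * x * (x * q) := by rw [h2]
  have a3 : (d * x - x * d) * (x * q) = 0 := by rw [h1, zero_mul]
  linear_combination (norm := noncomm_ring) -a1 + a2 + a2 + a3 + a3

theorem ring_aux6 (c p x w u k d a : R) (h1 : c * p + p * c = 2 * (x * w + w * x - u))
    (h2 : d * p - p * d = 2 * (x * (a - w) + (a - w) * x - (k - u))) :
    (x * a + a * x - k) + (x * a + a * x - k) = (c + d) * p + p * (c - d) := by
  linear_combination (norm := noncomm_ring) -h1 - h2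

end RingLemmas

namespace EuclideanJordanAlgebra

variable {V : Type*} [NormedAddCommGroup V] [InnerProductSpace ℝ V]
  [FiniteDimensional ℝ V] (J : EuclideanJordanAlgebra V)

/-- Left multiplication as an element of the endomorphism ring. -/
def M (x : V) : Module.End ℝ V := J.mul x

theorem M_apply (x y : V) : J.M x y = J.mul x y := rfl
theorem M_add (x y : V) : J.M (x + y) = J.M x + J.M y := by simp [M]
theorem M_sub (x y : V) : J.M (x - y) = J.M x - J.M y := by simp [M]
theorem M_e : J.M J.e = 1 := by
  ext x; exact J.unit x

/-- Fully linearized Jordan identity. -/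
theorem lin_jordan (a b c d : V) :
    J.mul a (J.mul (J.mul b c) d) + J.mul b (J.mul (J.mul c a) d)
      + J.mul c (J.mul (J.mul a b) d)
    = J.mul (J.mul b c) (J.mul a d) + J.mul (J.mul c a) (J.mul b d)
      + J.mul (J.mul a b) (J.mul c d) := by
  have h1 := J.jordan (a + b + c) d
  have h2 := J.jordan (a + b) d
  have h3 := J.jordan (b + c) d
  have h4 := J.jordan (a + c) d
  have h5 := J.jordan a d
  have h6 := J.jordan b d
  have h7 := J.jordan c d
  simp only [map_add, LinearMap.add_apply, J.comm b a, J.comm c b, J.comm c a] at h1 h2 h3 h4 ⊢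
  have key : (2 : ℝ) • (J.mul a (J.mul (J.mul b c) d) + J.mul b (J.mul (J.mul a c) d)
      + J.mul c (J.mul (J.mul a b) d))
    = (2 : ℝ) • (J.mul (J.mul b c) (J.mul a d) + J.mul (J.mul a c) (J.mul b d)
      + J.mul (J.mul a b) (J.mul c d)) := by
    linear_combination (norm := module) -h1 + h2 + h3 + h4 - h5 - h6 - h7
  exact smul_right_injective V (two_ne_zero) key

theorem J1 (a b c : V) :
    J.M a * J.M (J.mul b c) + J.M b * J.M (J.mul c a) + J.M c * J.M (J.mul a b)
    = J.M (J.mul b c) * J.M a + J.M (J.mul c a) * J.M b + J.M (J.mul a b) * J.M c := by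
  ext d; exact J.lin_jordan a b c d

theorem J2 (d b c : V) :
    J.M (J.mul d (J.mul b c)) = J.M (J.mul b c) * J.M d + J.M (J.mul d b) * J.M c
      + J.M (J.mul d c) * J.M b - J.M b * J.M d * J.M c - J.M c * J.M d * J.M b := by
  ext a
  have h := J.lin_jordan a b c d
  simp only [LinearMap.add_apply, LinearMap.sub_apply, Module.End.mul_apply, M_apply]
  have t1 : J.mul (J.mul d (J.mul b c)) a = J.mul a (J.mul (J.mul b c) d) := by
    rw [J.comm _ a, J.comm d]
  have t2 : J.mul b (J.mul d (J.mul c a)) = J.mul b (J.mul (J.mul c a) d) := by rw [J.comm d]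
  have t3 : J.mul c (J.mul d (J.mul b a)) = J.mul c (J.mul (J.mul a b) d) := by
    rw [J.comm d, J.comm b a]
  have t4 : J.mul (J.mul d b) (J.mul c a) = J.mul (J.mul c a) (J.mul b d) := by
    rw [J.comm (J.mul d b), J.comm d b]
  have t5 : J.mul (J.mul d c) (J.mul b a) = J.mul (J.mul a b) (J.mul c d) := by
    rw [J.comm (J.mul d c), J.comm d c, J.comm a b]
  rw [t1, t2, t3, t4, t5, J.comm d a]
  linear_combination (norm := module) h

theorem der (a b c : V) :
    (J.M a * J.M b - J.M b * J.M a) * J.M c - J.M c * (J.M a * J.M b - J.M b * J.M a)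
    = J.M (J.mul a (J.mul b c)) - J.M (J.mul b (J.mul a c)) := by
  rw [J.J2 a b c, J.J2 b a c, J.comm b a]
  noncomm_ring

theorem P_eq (x : V) : J.P x = (J.M x * J.M x + J.M x * J.M x - J.M (J.mul x x) : Module.End ℝ V) := by
  unfold P; rw [two_smul]; rfl

theorem comm_sq (x : V) : J.M x * J.M (J.mul x x) = J.M (J.mul x x) * J.M x := by
  ext y; exact (J.jordan x y).symm

/-- Bilinear quadratic representation, `2 P(x,c)`. -/
theorem quad_mul (c x : V) :
    J.M c * J.P x + J.P x * J.M c
    = 2 * (J.M x * J.M (J.mul c x) + J.M (J.mul c x) * J.M x - J.M (J.mul x (J.mul c x))) := by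
  have h1 := J.J2 x c x
  have h2 := J.J1 c x x
  rw [J.comm x c] at *
  rw [P_eq, h1]
  exact ring_aux1 _ _ _ _ h2

theorem quad_der (a b x : V) :
    (J.M a * J.M b - J.M b * J.M a) * J.P x - J.P x * (J.M a * J.M b - J.M b * J.M a)
    = 2 * (J.M x * J.M (J.mul a (J.mul b x) - J.mul b (J.mul a x))
      + J.M (J.mul a (J.mul b x) - J.mul b (J.mul a x)) * J.M x
      - J.M (J.mul x (J.mul a (J.mul b x) - J.mul b (J.mul a x)))) := by
  have h1 := J.der a b x
  have h2 := J.der a b (J.mul x x)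
  rw [← M_sub] at h1 h2
  have h3 : J.mul a (J.mul b (J.mul x x)) - J.mul b (J.mul a (J.mul x x))
      = J.mul x (J.mul a (J.mul b x) - J.mul b (J.mul a x))
        + J.mul x (J.mul a (J.mul b x) - J.mul b (J.mul a x)) := by
    have := congrArg (fun T : Module.End ℝ V => T x) h1
    simp only [LinearMap.sub_apply, Module.End.mul_apply, M_apply] at this
    rw [J.comm (J.mul a (J.mul b x) - J.mul b (J.mul a x)) x] at this
    simp only [map_sub] at this ⊢
    linear_combination (norm := module) this
  rw [h3, M_add] at h2
  rw [P_eq]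
  exact ring_aux2 _ _ _ _ _ h1 h2

theorem trace_assoc (a b c : V) :
    LinearMap.trace ℝ V (J.M (J.mul a (J.mul b c)))
      = LinearMap.trace ℝ V (J.M (J.mul b (J.mul a c))) := by
  have h := congrArg (LinearMap.trace ℝ V) (J.der a b c)
  rw [map_sub, map_sub, LinearMap.trace_mul_comm, sub_self] at h
  linarith

theorem exists_trace_eq (hs : J.IsSimple) :
    ∃ t : ℝ, ∀ y, LinearMap.trace ℝ V (J.M y) = t * ⟪J.e, y⟫ := by
  obtain ⟨hnt, hI⟩ := hs
  let τ : V →ₗ[ℝ] ℝ := (LinearMap.trace ℝ V).comp (J.mul : V →ₗ[ℝ] Module.End ℝ V)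
  have hτ : ∀ y, τ y = LinearMap.trace ℝ V (J.M y) := fun y => rfl
  let w : V := (InnerProductSpace.toDual ℝ V).symm (LinearMap.toContinuousLinearMap τ)
  have hw : ∀ y, ⟪w, y⟫ = τ y := fun y => by
    simp [w]
  let T : V →ₗ[ℝ] V := J.mul w
  have hT : ∀ x y, ⟪T x, y⟫ = τ (J.mul x y) := fun x y => by
    rw [← hw]
    change ⟪J.mul w x, y⟫ = _
    rw [J.comm, J.compat]
  have hTs : T.IsSymmetric := fun x y => by
    rw [hT, real_inner_comm, hT, J.comm]
  have hTL : ∀ z y, T (J.mul z y) = J.mul z (T y) := fun z y => by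
    refine ext_inner_right ℝ fun u => ?_
    rw [J.compat z, hT, hT, hτ, hτ, J.comm (J.mul z y) u, J.trace_assoc u z y, 
      J.comm u y, J.trace_assoc z y u]
  have hne : 0 < Module.finrank ℝ V := Module.finrank_pos
  let i : Fin (Module.finrank ℝ V) := ⟨0, hne⟩
  let t := hTs.eigenvalues rfl i
  have hev : Module.End.HasEigenvalue T t := hTs.hasEigenvalue_eigenvalues rfl i
  refine ⟨t, fun y => ?_⟩
  have := hI (Module.End.eigenspace T t) (fun z y hy => by
    rw [Module.End.mem_eigenspace_iff] at hy ⊢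
    rw [hTL, hy, map_smul])
  rcases this with h | h
  · exact absurd h hev
  · have he : J.e ∈ Module.End.eigenspace T t := by rw [h]; trivial
    rw [Module.End.mem_eigenspace_iff] at he
    have h2 := hT J.e y
    rw [he, J.unit, hτ, real_inner_smul_left] at h2
    exact h2.symm

theorem inner_e (htr : J.TraceNormalized) {r : ℕ} (p : Fin r → V) (hp : J.IsJordanFrame p) :
    ⟪J.e, J.e⟫ = (r : ℝ) := by
  obtain ⟨h1, h2, h3⟩ := hp
  have h4 : ∀ i, ⟪p i, J.e⟫ = 1 := fun i => by
    rw [← htr _ (h1 i)]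
    have h5 : J.mul (p i) (p i) = p i := (h1 i).1
    nth_rw 1 [← h5]
    rw [J.compat, J.comm, J.unit]
  nth_rw 1 [← h3]
  rw [sum_inner]
  simp [h4]

theorem trace_M (hs : J.IsSimple) (htr : J.TraceNormalized) {n r : ℕ}
    (hn : Module.finrank ℝ V = n) (hr : J.HasRank r) (y : V) :
    LinearMap.trace ℝ V (J.M y) = ((n : ℝ) / (r : ℝ)) * ⟪J.e, y⟫ := by
  obtain ⟨t, ht⟩ := J.exists_trace_eq hs
  obtain ⟨⟨p, hp⟩, -⟩ := hr
  have h1 := ht J.e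
  rw [M_e, J.inner_e htr p hp, LinearMap.trace_one, hn] at h1
  have := hs.1
  have hne : 0 < Module.finrank ℝ V := Module.finrank_pos
  have hr0 : (r : ℝ) ≠ 0 := by
    intro h
    rw [h, mul_zero] at h1
    rw [hn] at hne
    have : (0 : ℝ) < n := by exact_mod_cast hne
    linarith
  rw [ht, h1]
  field_simp

/-- Facts on the inverse. -/
theorem inv_comm (x y : V) (Q : Module.End ℝ V) (h1 : Q * J.P x = 1) (h2 : J.P x * Q = 1)
    (hy : y = Q x) : J.mul x y = J.e ∧ J.M x * J.M y = J.M y * J.M x := by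
  have hc := J.comm_sq x
  have hPX : J.P x * J.M x = J.M x * J.P x := by rw [P_eq]; exact ring_aux3 _ _ hc
  have hQX : Q * J.M x = J.M x * Q := by
    calc Q * J.M x = Q * J.M x * (J.P x * Q) := by rw [h2, mul_one]
      _ = Q * (J.M x * J.P x) * Q := by noncomm_ring
      _ = (Q * J.P x) * J.M x * Q := by rw [← hPX]; noncomm_ring
      _ = J.M x * Q := by rw [h1, one_mul]
  have hPe : J.P x J.e = J.mul x x := by
    rw [P_eq]
    simp only [LinearMap.add_apply, LinearMap.sub_apply, Module.End.mul_apply, M_apply,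
      J.comm _ J.e, J.unit]
    abel
  have hPy : J.P x y = x := by
    rw [hy]; exact congrArg (fun T : Module.End ℝ V => T x) h2
  have hxy : J.mul x y = J.e := by
    calc J.mul x y = (J.M x * Q) x := by rw [hy]; rfl
      _ = Q (J.mul x x) := by rw [← hQX]; rfl
      _ = (Q * J.P x) J.e := by rw [← hPe]; rfl
      _ = J.e := by rw [h1]; rfl
  refine ⟨hxy, ?_⟩
  have hx2y : J.mul (J.mul x x) y = x := by
    have := hPy
    rw [P_eq] at this
    simp only [LinearMap.add_apply, LinearMap.sub_apply, Module.End.mul_apply, M_apply, hxy,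
      J.comm x J.e, J.unit] at this
    linear_combination (norm := module) -this
  have hyx2 : J.mul y (J.mul x x) = x := by rw [J.comm, hx2y]
  have hyx : J.mul y x = J.e := by rw [J.comm, hxy]
  have e1 := J.J1 x x y
  have e2 := J.J2 y x x
  have e3 := J.J2 x x y
  have e4 := J.der x y x
  simp only [hxy, hyx, hyx2, M_e, J.comm x J.e, J.unit, sub_self, mul_one, one_mul] at e1 e2 e3 e4
  have hYP : J.M y * J.P x = J.M x - 2 * ((J.M x * J.M y - J.M y * J.M x) * J.M x) := by
    rw [P_eq]; exact ring_aux4 _ _ _ e1 e2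
  have hY : J.M y = (J.M x - 2 * ((J.M x * J.M y - J.M y * J.M x) * J.M x)) * Q := by
    rw [← hYP, mul_assoc, h2, mul_one]
  have h5 := ring_aux5 _ _ Q e4 hQX
  rw [← hY] at h5
  exact h5

theorem trace_key (x y α : V) (Q : Module.End ℝ V) (h1 : Q * J.P x = 1) (h2 : J.P x * Q = 1)
    (hy : y = Q x) :
    LinearMap.trace ℝ V ((J.M x * J.M α + J.M α * J.M x - J.M (J.mul x α)) * Q)
      = LinearMap.trace ℝ V (J.M (J.mul α y)) := by
  obtain ⟨hxy, hc⟩ := J.inv_comm x y Q h1 h2 hy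
  have q1 := J.quad_mul (J.mul α y) x
  have q2 := J.quad_der α y x
  have hTx : J.mul (J.mul α y) x + (J.mul α (J.mul y x) - J.mul y (J.mul α x)) = α := by
    have := congrArg (fun T : Module.End ℝ V => T α) hc
    simp only [Module.End.mul_apply, M_apply] at this
    rw [J.comm (J.mul α y), J.comm α y, this, J.comm y x, hxy, J.comm α J.e, J.unit, J.comm α x]
    abel
  have hTx' : J.mul α (J.mul y x) - J.mul y (J.mul α x) = α - J.mul (J.mul α y) x := by
    rw [eq_sub_iff_add_eq, add_comm]; exact hTx
  rw [hTx'] at q2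
  rw [map_sub, M_sub, M_sub] at q2
  have q3 : (J.M x * J.M α + J.M α * J.M x - J.M (J.mul x α))
        + (J.M x * J.M α + J.M α * J.M x - J.M (J.mul x α))
      = (J.M (J.mul α y) + (J.M α * J.M y - J.M y * J.M α)) * J.P x
        + J.P x * (J.M (J.mul α y) - (J.M α * J.M y - J.M y * J.M α)) := by
    exact ring_aux6 _ _ _ _ _ _ _ _ q1 q2
  have q4 := congrArg (fun T => LinearMap.trace ℝ V (T * Q)) q3
  simp only [add_mul _ _ Q, map_add] at q4
  rw [mul_assoc _ (J.P x) Q, h2, mul_one, LinearMap.trace_mul_comm ℝ (J.P x * _) Q, ← mul_assoc, h1,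
    one_mul, map_add, map_sub, map_sub, LinearMap.trace_mul_comm ℝ (J.M α), sub_self, add_zero,
    map_sub, LinearMap.trace_mul_comm ℝ (J.M α), sub_self, sub_zero] at q4
  linarith

end EuclideanJordanAlgebra

/-- trace identity.  In a simple Euclidean Jordan algebra of dimension
`n` and rank `r` with trace-normalized inner product, if `α` belongs to the cone of
squares, `x ∈ V` has invertible quadratic representation `P(x)` (with inverse
`Pinv`, so `x⁻¹ = Pinv x`), and `A` is a symmetric linear operator with
`⟪u, A u⟫ = 4 ⟪x, P(u) α⟫` for all `u`, then
`Tr(A ∘ P(x)⁻¹) = 4 (n/r) ⟪x⁻¹, α⟫`. -/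
theorem trace_A_Pinv
    {V : Type*} [NormedAddCommGroup V] [InnerProductSpace ℝ V] [FiniteDimensional ℝ V]
    (J : EuclideanJordanAlgebra V) (hsimple : J.IsSimple) (htr : J.TraceNormalized)
    (n r : ℕ) (hn : Module.finrank ℝ V = n) (hrank : J.HasRank r)
    (α : V) (hα : α ∈ J.cone)
    (x : V) (Pinv : V →ₗ[ℝ] V)
    (hPinv₁ : Pinv ∘ₗ J.P x = LinearMap.id)
    (hPinv₂ : J.P x ∘ₗ Pinv = LinearMap.id)
    (A : V →ₗ[ℝ] V)
    (hAsym : ∀ u v : V, ⟪A u, v⟫ = ⟪u, A v⟫)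
    (hA : ∀ u : V, ⟪u, A u⟫ = 4 * ⟪x, J.P u α⟫) :
    LinearMap.trace ℝ V (A ∘ₗ Pinv) = 4 * ((n : ℝ) / (r : ℝ)) * ⟪Pinv x, α⟫ := by
  have hPu : ∀ u, ⟪x, J.P u α⟫ = 2 * ⟪J.mul x u, J.mul u α⟫ - ⟪J.mul u u, J.mul x α⟫ := by
    intro u
    rw [J.P_eq]
    simp only [LinearMap.add_apply, LinearMap.sub_apply, Module.End.mul_apply,
      EuclideanJordanAlgebra.M_apply, inner_add_right, inner_sub_right]
    rw [← J.compat u x, J.comm u x, ← J.compat (J.mul u u) x, J.comm (J.mul u u) x,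
      J.compat x (J.mul u u)]
    ring
  have hLs : ∀ a u v : V, ⟪J.M a u, v⟫ = ⟪u, J.M a v⟫ := fun a u v => J.compat a u v
  let B : Module.End ℝ V := (4 : ℝ) • (J.M x * J.M α + J.M α * J.M x - J.M (J.mul x α))
  have hAB : A = B := by
    have hsym : (A - B).IsSymmetric := by
      intro u v
      simp only [B, LinearMap.sub_apply, LinearMap.smul_apply, LinearMap.add_apply,
        Module.End.mul_apply, inner_sub_left, inner_sub_right, inner_add_left, inner_add_right,
        real_inner_smul_left, real_inner_smul_right, hAsym, hLs]
      ring
    have hz := hsym.inner_map_self_eq_zero.mp (fun u => by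
      rw [LinearMap.sub_apply, inner_sub_left, hAsym, hA, hPu]
      simp only [B, LinearMap.sub_apply, LinearMap.smul_apply, LinearMap.add_apply,
        Module.End.mul_apply, inner_sub_left, inner_add_left, real_inner_smul_left, hLs]
      simp only [EuclideanJordanAlgebra.M_apply]
      have s1 : ⟪u, J.mul α (J.mul x u)⟫ = ⟪J.mul x u, J.mul u α⟫ := by
        rw [← J.compat, real_inner_comm, J.comm α u]
      have s2 : ⟪u, J.mul x (J.mul α u)⟫ = ⟪J.mul x u, J.mul u α⟫ := by
        rw [← J.compat, J.comm α u]
      have s3 : ⟪u, J.mul (J.mul x α) u⟫ = ⟪J.mul u u, J.mul x α⟫ := by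
        rw [J.compat, J.comm (J.mul x α) u]
      rw [s1, s2, s3]
      ring)
    exact sub_eq_zero.mp hz
  have key := J.trace_key x (Pinv x) α Pinv hPinv₁ hPinv₂ rfl
  rw [J.trace_M hsimple htr hn hrank] at key
  have h0 : A ∘ₗ Pinv = (4 : ℝ) • ((J.M x * J.M α + J.M α * J.M x - J.M (J.mul x α))
      * (Pinv : Module.End ℝ V)) := by
    rw [hAB]
    simp only [B, ← smul_mul_assoc]
    rfl
  have h1 : ⟪J.e, J.mul α (Pinv x)⟫ = ⟪Pinv x, α⟫ := by
    rw [← J.compat, J.comm, J.unit, real_inner_comm]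
  rw [h0, map_smul, key, h1, smul_eq_mul]
  ring
end
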